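/- arXiv:1801.10539 — 2 statements merged into one kernel-verified Lean document; each statement's English description precedes it below -/
import Mathlib

section
/- Let m ≥ 2, 0 < a ≤ 1/4, and suppose either m > 2 and 1/(m−1) < α < 1/(m−2), or m = 2 and α > 1/(m−1) = 1. Let (z_i)_{i∈ℕ} be an enumeration of ℤ^m in ℝ^m, set r_i = a i^{-α}, and let Ω = ⋃_{i∈ℕ} B(z_i; r_i). Let F_Ω(t) = |Ω| − H_Ω(t) denote the heat loss and let P = ∑_{i=1}^∞ m ω_m (a i^{-α})^{m−1} (the perimeter of Ω, being the sum of the surface areas of the balls), where ω_m is the volume of the unit ball in ℝ^m. Then, as t ↓ 0, F_Ω(t) − π^{-1/2} P t^{1/2} = O(t^{(mα−1)/(2α)}). -/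
open MeasureTheory Metric ENNReal

/-- The heat content of an open set `Ω ⊆ ℝᵐ` at time `t`, computed with the Euclidean
heat kernel `p(x,y;t) = (4πt)^{-m/2} e^{-|x-y|²/(4t)}`. -/
noncomputable def heatContent {m : ℕ} (Ω : Set (EuclideanSpace ℝ (Fin m))) (t : ℝ) :
    ℝ≥0∞ :=
  ∫⁻ x in Ω, ∫⁻ y in Ω,
    ENNReal.ofReal ((4 * Real.pi * t) ^ (-(m : ℝ) / 2) * Real.exp (-dist x y ^ 2 / (4 * t)))

/-- `z : ℕ → ℝᵐ` is an enumeration of the integer lattice `ℤᵐ ⊆ ℝᵐ`. -/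
def IsLatticeEnum (m : ℕ) (z : ℕ → EuclideanSpace ℝ (Fin m)) : Prop :=
  Function.Injective z ∧
    Set.range z = {x : EuclideanSpace ℝ (Fin m) | ∀ j : Fin m, ∃ k : ℤ, x j = (k : ℝ)}

/-- The Euclidean heat kernel at time `t`, as a function of the displacement. -/
noncomputable def heatKernel {m : ℕ} (t : ℝ) (x : EuclideanSpace ℝ (Fin m)) : ℝ :=
  (4 * Real.pi * t) ^ (-(m : ℝ) / 2) * Real.exp (-‖x‖ ^ 2 / (4 * t))

lemma heatKernel_nonneg {m : ℕ} {t : ℝ} (ht : 0 < t) (x : EuclideanSpace ℝ (Fin m)) :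
    0 ≤ heatKernel t x := by
  unfold heatKernel; positivity

lemma continuous_heatKernel {m : ℕ} (t : ℝ) :
    Continuous (heatKernel t : EuclideanSpace ℝ (Fin m) → ℝ) := by
  unfold heatKernel; fun_prop

/-- Absolute moments of the heat kernel in dimension `n + 1`. -/
lemma lintegral_heatKernel_mul_rpow (n : ℕ) {t q : ℝ} (ht : 0 < t) (hq : 0 ≤ q) :
    ∫⁻ x : EuclideanSpace ℝ (Fin (n + 1)), ENNReal.ofReal (heatKernel t x * ‖x‖ ^ q) =
      ENNReal.ofReal (((n : ℝ) + 1) *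
        volume.real (ball (0 : EuclideanSpace ℝ (Fin (n + 1))) 1) *
        (Real.pi ^ (-((n : ℝ) + 1) / 2) / 2 * Real.Gamma ((n + 1 + q) / 2)) *
          (4 * t) ^ (q / 2)) := by
  set E := EuclideanSpace ℝ (Fin (n + 1))
  let f : ℝ → ℝ := fun y ↦
    (4 * Real.pi * t) ^ (-((n + 1 : ℕ) : ℝ) / 2) * Real.exp (-y ^ 2 / (4 * t)) * y ^ q
  have hb : 0 < (4 * t)⁻¹ := by positivity
  have hnq : -1 < (n : ℝ) + q := by linarith [n.cast_nonneg (α := ℝ)]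
  have hfin : Module.finrank ℝ E = n + 1 := by simp [E]
  have hrad : ∀ y ∈ Set.Ioi (0 : ℝ), y ^ (Module.finrank ℝ E - 1) • f y =
      (4 * Real.pi * t) ^ (-((n : ℝ) + 1) / 2) *
        (y ^ (n + q) * Real.exp (-(4 * t)⁻¹ * y ^ (2 : ℝ))) := by
    intro y hy
    have hy : 0 < y := hy
    have h1 : -y ^ 2 / (4 * t) = -(4 * t)⁻¹ * y ^ (2 : ℝ) := by
      rw [Real.rpow_two]; ring
    simp only [f, hfin, Nat.add_sub_cancel, smul_eq_mul, h1, Real.rpow_add hy,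
      Real.rpow_natCast]
    push_cast
    ring
  have hint : Integrable (fun x : E ↦ f ‖x‖) := by
    rw [integrable_fun_norm_addHaar]
    refine IntegrableOn.congr_fun ?_ (fun y hy ↦ (hrad y hy).symm) measurableSet_Ioi
    exact (integrableOn_rpow_mul_exp_neg_mul_rpow hnq two_pos hb).const_mul _
  have hval := integral_fun_norm_addHaar (volume : Measure E) f
  rw [setIntegral_congr_fun measurableSet_Ioi hrad, integral_const_mul,
    integral_rpow_mul_exp_neg_mul_rpow two_pos hnq hb, hfin] at hval
  have h0 : 0 ≤ᵐ[volume] fun x : E ↦ f ‖x‖ := ae_of_all _ fun x ↦ by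
    simp only [f, Pi.zero_apply]; positivity
  have key := ofReal_integral_eq_lintegral_ofReal hint h0
  rw [hval] at key
  change ∫⁻ x : E, ENNReal.ofReal (f ‖x‖) = _
  rw [← key]
  congr 1
  have e1 : ((4 * t)⁻¹) ^ (-((n : ℝ) + q + 1) / 2) =
      (4 * t) ^ (((n : ℝ) + 1) / 2) * (4 * t) ^ (q / 2) := by
    rw [Real.inv_rpow (by positivity), ← Real.rpow_neg (by positivity),
      ← Real.rpow_add (by positivity)]
    congr 1; ring
  have e2 : (4 * Real.pi * t) ^ (-((n : ℝ) + 1) / 2) =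
      (4 * t) ^ (-((n : ℝ) + 1) / 2) * Real.pi ^ (-((n : ℝ) + 1) / 2) := by
    rw [← Real.mul_rpow (by positivity) (by positivity)]; congr 1; ring
  have e3 : (4 * t) ^ (-((n : ℝ) + 1) / 2) * (4 * t) ^ (((n : ℝ) + 1) / 2) = 1 := by
    rw [← Real.rpow_add (by positivity), neg_div, neg_add_cancel, Real.rpow_zero]
  rw [e1, e2, show (n : ℝ) + q + 1 = n + 1 + q by ring]
  simp only [nsmul_eq_mul, smul_eq_mul]
  push_cast
  linear_combination ((n : ℝ) + 1) * volume.real (ball (0 : E) 1) *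
    (Real.pi ^ (-((n : ℝ) + 1) / 2) / 2 * Real.Gamma ((n + 1 + q) / 2)) *
          (4 * t) ^ (q / 2) * e3

lemma volume_real_unitBall (n : ℕ) :
    volume.real (ball (0 : EuclideanSpace ℝ (Fin n)) 1) =
      Real.pi ^ ((n : ℝ) / 2) / Real.Gamma (n / 2 + 1) := by
  have h : √Real.pi ^ n = Real.pi ^ ((n : ℝ) / 2) := by
    rw [Real.sqrt_eq_rpow, ← Real.rpow_natCast, ← Real.rpow_mul Real.pi_pos.le]
    congr 1; ring
  rcases Nat.eq_zero_or_pos n with rfl | hn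
  · have : ball (0 : EuclideanSpace ℝ (Fin 0)) 1 = Set.univ :=
      Set.eq_univ_of_forall fun x ↦ by simp [Subsingleton.elim x 0]
    have hv : (volume : Measure (EuclideanSpace ℝ (Fin 0))) = Measure.dirac 0 :=
      volume_euclideanSpace_eq_dirac _
    simp [this, hv]
  · have : Nonempty (Fin n) := ⟨⟨0, hn⟩⟩
    rw [measureReal_def, EuclideanSpace.volume_ball]
    simp only [Fintype.card_fin, ENNReal.ofReal_one, one_pow, one_mul, h]
    exact ENNReal.toReal_ofReal (div_nonneg (by positivity)
      (Real.Gamma_pos_of_pos (by positivity)).le)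

lemma lintegral_heatKernel (n : ℕ) {t : ℝ} (ht : 0 < t) :
    ∫⁻ x : EuclideanSpace ℝ (Fin (n + 1)), ENNReal.ofReal (heatKernel t x) = 1 := by
  have h := lintegral_heatKernel_mul_rpow n ht le_rfl
  simp only [Real.rpow_zero, mul_one, zero_div, add_zero] at h
  rw [h, volume_real_unitBall, ← ENNReal.ofReal_one]
  congr 1
  have hG : 0 < Real.Gamma (((n : ℝ) + 1) / 2) := Real.Gamma_pos_of_pos (by positivity)
  have hp : 0 < Real.pi ^ (((n : ℝ) + 1) / 2) := by positivity
  push_cast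
  rw [Real.Gamma_add_one (by positivity), neg_div, Real.rpow_neg Real.pi_pos.le]
  field_simp

/-- The first absolute moment of the heat kernel, against the unit ball one dimension lower. -/
lemma lintegral_heatKernel_mul_norm (n : ℕ) {t : ℝ} (ht : 0 < t) :
    ENNReal.ofReal (volume.real (ball (0 : EuclideanSpace ℝ (Fin n)) 1)) *
      ∫⁻ x : EuclideanSpace ℝ (Fin (n + 1)), ENNReal.ofReal (heatKernel t x * ‖x‖) =
      ENNReal.ofReal (Real.pi ^ (-(1 : ℝ) / 2) * (((n : ℝ) + 1) *
        volume.real (ball (0 : EuclideanSpace ℝ (Fin (n + 1))) 1)) * √t) := by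
  have h := lintegral_heatKernel_mul_rpow n ht zero_le_one
  simp only [Real.rpow_one] at h
  rw [h, ← ENNReal.ofReal_mul measureReal_nonneg, volume_real_unitBall n]
  congr 1
  have hG : 0 < Real.Gamma ((n : ℝ) / 2 + 1) := Real.Gamma_pos_of_pos (by positivity)
  have e1 : ((n : ℝ) + 1 + 1) / 2 = n / 2 + 1 := by ring
  have e2 : (4 * t) ^ ((1 : ℝ) / 2) = 2 * √t := by
    rw [← Real.sqrt_eq_rpow, Real.sqrt_mul (by norm_num)]
    congr 1
    rw [show (4 : ℝ) = 2 ^ 2 by norm_num]; exact Real.sqrt_sq two_pos.le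
  have e3 : Real.pi ^ ((n : ℝ) / 2) * Real.pi ^ (-((n : ℝ) + 1) / 2) =
      Real.pi ^ (-(1 : ℝ) / 2) := by
    rw [← Real.rpow_add Real.pi_pos]; congr 1; ring
  rw [e1, e2, ← e3]
  field_simp

/-- Heat content plus the kernel-weighted covariogram deficit is the total volume. -/
lemma heatContent_add_lintegral (n : ℕ) {Ω : Set (EuclideanSpace ℝ (Fin (n + 1)))}
    (hΩ : MeasurableSet Ω) {t : ℝ} (ht : 0 < t) :
    heatContent Ω t + ∫⁻ h, ENNReal.ofReal (heatKernel t h) *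
      volume {x | x ∈ Ω ∧ x - h ∉ Ω} = volume Ω := by
  have hk : Measurable (heatKernel t : EuclideanSpace ℝ (Fin (n + 1)) → ℝ) :=
    (continuous_heatKernel t).measurable
  have hmeas : MeasurableSet {p : EuclideanSpace ℝ (Fin (n + 1)) × EuclideanSpace ℝ (Fin (n + 1)) |
      p.2 ∈ Ω ∧ p.2 - p.1 ∈ Ω} :=
    (measurable_snd hΩ).inter ((measurable_snd.sub measurable_fst) hΩ)
  have hH : heatContent Ω t = ∫⁻ h, ENNReal.ofReal (heatKernel t h) *
      volume {x | x ∈ Ω ∧ x - h ∈ Ω} := by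
    calc heatContent Ω t
        = ∫⁻ x in Ω, ∫⁻ h, Ω.indicator (fun _ ↦ ENNReal.ofReal (heatKernel t h)) (x - h) := by
          unfold heatContent
          refine lintegral_congr fun x ↦ ?_
          rw [← lintegral_indicator hΩ, ← lintegral_sub_left_eq_self _ x]
          refine lintegral_congr fun h ↦ ?_
          by_cases hxh : x - h ∈ Ω <;> simp [hxh, heatKernel, dist_eq_norm]
      _ = ∫⁻ x, ∫⁻ h, {p : EuclideanSpace ℝ (Fin (n + 1)) × EuclideanSpace ℝ (Fin (n + 1)) |
            p.2 ∈ Ω ∧ p.2 - p.1 ∈ Ω}.indicator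
              (fun p ↦ ENNReal.ofReal (heatKernel t p.1)) (h, x) := by
          rw [← lintegral_indicator hΩ]
          refine lintegral_congr fun x ↦ ?_
          by_cases hx : x ∈ Ω
          · rw [Set.indicator_of_mem hx]
            refine lintegral_congr fun h ↦ ?_
            by_cases hxh : x - h ∈ Ω <;> simp [hx, hxh]
          · simp [hx]
      _ = ∫⁻ h, ∫⁻ x, {p : EuclideanSpace ℝ (Fin (n + 1)) × EuclideanSpace ℝ (Fin (n + 1)) |
            p.2 ∈ Ω ∧ p.2 - p.1 ∈ Ω}.indicator
              (fun p ↦ ENNReal.ofReal (heatKernel t p.1)) (h, x) := by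
          rw [lintegral_lintegral_swap]
          refine Measurable.aemeasurable (Measurable.comp (f := Prod.swap)
            (g := {p : EuclideanSpace ℝ (Fin (n + 1)) × EuclideanSpace ℝ (Fin (n + 1)) |
            p.2 ∈ Ω ∧ p.2 - p.1 ∈ Ω}.indicator
              (fun p ↦ ENNReal.ofReal (heatKernel t p.1))) ?_ measurable_swap)
          exact ((hk.comp measurable_fst).ennreal_ofReal).indicator hmeas
      _ = _ := by
          refine lintegral_congr fun h ↦ ?_
          exact lintegral_indicator_const (μ := volume) (measurable_prodMk_left (x := h) hmeas)
            (ENNReal.ofReal (heatKernel t h))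
  have hmv : Measurable fun h : EuclideanSpace ℝ (Fin (n + 1)) ↦
      volume {x | x ∈ Ω ∧ x - h ∈ Ω} := measurable_measure_prodMk_left hmeas
  have hkv : Measurable fun h : EuclideanSpace ℝ (Fin (n + 1)) ↦
      ENNReal.ofReal (heatKernel t h) * volume {x | x ∈ Ω ∧ x - h ∈ Ω} := hk.ennreal_ofReal.mul hmv
  rw [hH, ← lintegral_add_left hkv]
  calc _ = ∫⁻ h, ENNReal.ofReal (heatKernel t h) * volume Ω := by
        refine lintegral_congr fun h ↦ ?_
        have : MeasurableSet {x | x - h ∈ Ω} := (measurable_id.sub_const h) hΩ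
        rw [← mul_add]
        congr 1
        exact measure_inter_add_sdiff Ω this
    _ = _ := by rw [lintegral_mul_const _ hk.ennreal_ofReal, lintegral_heatKernel n ht, one_mul]

/-- Splitting off the first coordinate. -/
lemma measurePreserving_head_tail (n : ℕ) :
    MeasurePreserving (fun x : EuclideanSpace ℝ (Fin (n + 1)) ↦
      ((x 0, WithLp.toLp 2 fun j : Fin n ↦ x j.succ) : ℝ × EuclideanSpace ℝ (Fin n))) :=
  ((MeasurePreserving.id volume).prod (PiLp.volume_preserving_toLp (Fin n))).comp
    ((volume_preserving_piFinSuccAbove (fun _ : Fin (n + 1) ↦ ℝ) 0).comp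
      (PiLp.volume_preserving_ofLp (Fin (n + 1))))

lemma volume_ball_inter_shift_compl (n : ℕ) {r : ℝ} (hr : 0 ≤ r)
    (z h : EuclideanSpace ℝ (Fin (n + 1))) :
    volume {x | x ∈ ball z r ∧ x - h ∉ ball z r} =
      ∫⁻ y : EuclideanSpace ℝ (Fin n),
        volume {u : ℝ | u ^ 2 + ‖y‖ ^ 2 < r ^ 2 ∧ r ^ 2 ≤ (u - ‖h‖) ^ 2 + ‖y‖ ^ 2} := by
  let e : EuclideanSpace ℝ (Fin (n + 1)) := EuclideanSpace.single 0 ‖h‖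
  have he : ‖h‖ = ‖e‖ := by simp [e]
  let ρ : EuclideanSpace ℝ (Fin (n + 1)) ≃ₗᵢ[ℝ]
      EuclideanSpace ℝ (Fin (n + 1)) := (ℝ ∙ (h - e))ᗮ.reflection
  have hρ : ρ h = e := Submodule.reflection_sub he
  set T : Set (ℝ × EuclideanSpace ℝ (Fin n)) :=
    {p | p.1 ^ 2 + ‖p.2‖ ^ 2 < r ^ 2 ∧ r ^ 2 ≤ (p.1 - ‖h‖) ^ 2 + ‖p.2‖ ^ 2} with hT
  have hTm : MeasurableSet T :=
    (measurableSet_lt (f := fun p : ℝ × EuclideanSpace ℝ (Fin n) ↦ p.1 ^ 2 + ‖p.2‖ ^ 2)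
      (by fun_prop) measurable_const).inter
    (measurableSet_le measurable_const
      (g := fun p : ℝ × EuclideanSpace ℝ (Fin n) ↦ (p.1 - ‖h‖) ^ 2 + ‖p.2‖ ^ 2) (by fun_prop))
  have hnorm (x : EuclideanSpace ℝ (Fin (n + 1))) : ‖x‖ ^ 2 = x 0 ^ 2 +
      ‖(WithLp.toLp 2 fun j : Fin n ↦ x j.succ : EuclideanSpace ℝ (Fin n))‖ ^ 2 := by
    simp [EuclideanSpace.norm_sq_eq, Fin.sum_univ_succ]
  have hsub : {x : EuclideanSpace ℝ (Fin (n + 1)) | x ∈ ball z r ∧ x - h ∉ ball z r} =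
      (fun x ↦ x + -z) ⁻¹' (ρ ⁻¹' ((fun x : EuclideanSpace ℝ (Fin (n + 1)) ↦
        ((x 0, WithLp.toLp 2 fun j : Fin n ↦ x j.succ) : ℝ × EuclideanSpace ℝ (Fin n))) ⁻¹' T)) := by
    ext x
    have h1 : ‖x - z‖ ^ 2 = ‖ρ (x + -z)‖ ^ 2 := by
      rw [LinearIsometryEquiv.norm_map, sub_eq_add_neg]
    have h2 : ‖x - h - z‖ ^ 2 = ‖ρ (x + -z) - e‖ ^ 2 := by
      rw [← hρ, ← map_sub, LinearIsometryEquiv.norm_map]; congr 2; abel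
    rw [hnorm] at h1 h2
    rw [hnorm (ρ _)] at h1
    rw [hnorm (ρ _ - e)] at h2
    have h3 : (WithLp.toLp 2 fun j : Fin n ↦ (ρ (x + -z) - e) j.succ :
      EuclideanSpace ℝ (Fin n)) = WithLp.toLp 2 fun j : Fin n ↦ ρ (x + -z) j.succ := by
      ext j; simp [e]
    have h4 : (ρ (x + -z) - e) 0 = ρ (x + -z) 0 - ‖h‖ := by simp [e]
    rw [h3, h4, ← hnorm] at h2
    rw [← hnorm] at h1
    simp only [Set.mem_ofPred_eq, mem_ball, dist_eq_norm, Set.mem_preimage, hT, not_lt]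
    rw [← h1, ← h2, sq_lt_sq₀ (norm_nonneg _) hr, sq_le_sq₀ hr (norm_nonneg _)]
  rw [hsub, measure_preimage_add_right,
    ρ.measurePreserving.measure_preimage
      ((measurePreserving_head_tail n).measurable hTm).nullMeasurableSet,
    (measurePreserving_head_tail n).measure_preimage hTm.nullMeasurableSet,
    Measure.volume_eq_prod, Measure.prod_apply_symm hTm]
  rfl

lemma volume_ball_eq_ofReal_pow (n : ℕ) (hn : 1 ≤ n) {r : ℝ} (hr : 0 ≤ r)
    (z : EuclideanSpace ℝ (Fin n)) :
    volume (ball z r) =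
      ENNReal.ofReal (volume.real (ball (0 : EuclideanSpace ℝ (Fin n)) 1) * r ^ n) := by
  have : Nonempty (Fin n) := ⟨⟨0, hn⟩⟩
  rw [Measure.addHaar_ball _ _ hr, mul_comm, ENNReal.ofReal_mul measureReal_nonneg,
    ofReal_measureReal measure_ball_lt_top.ne]
  simp

/-- The part of a ball not covered by its translate by `h` has volume at most
`|h|` times the volume of the equatorial disc. -/
lemma volume_ball_inter_shift_compl_le (n : ℕ) (hn : 1 ≤ n) {r : ℝ} (hr : 0 ≤ r)
    (z h : EuclideanSpace ℝ (Fin (n + 1))) :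
    volume {x | x ∈ ball z r ∧ x - h ∉ ball z r} ≤
      ENNReal.ofReal (volume.real (ball (0 : EuclideanSpace ℝ (Fin n)) 1) * r ^ n * ‖h‖) := by
  rw [volume_ball_inter_shift_compl n hr, ENNReal.ofReal_mul (by positivity),
    ← volume_ball_eq_ofReal_pow n hn hr 0, mul_comm, ← lintegral_indicator_const measurableSet_ball]
  refine lintegral_mono fun y ↦ ?_
  by_cases hy : y ∈ ball 0 r
  · rw [Set.indicator_of_mem hy]
    set l := √(r ^ 2 - ‖y‖ ^ 2)
    calc _ ≤ volume (Set.Icc (-l) (-l + ‖h‖)) := by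
          refine measure_mono fun u ⟨h1, h2⟩ ↦ ?_
          have hl : u ^ 2 < l ^ 2 := by
            rw [Real.sq_sqrt] <;> nlinarith [sq_nonneg u]
          have hl0 : 0 ≤ l := Real.sqrt_nonneg _
          have hl' : l ^ 2 ≤ (u - ‖h‖) ^ 2 := by
            rw [Real.sq_sqrt] <;> nlinarith [sq_nonneg u]
          have h3 := abs_lt_of_sq_lt_sq' hl hl0
          refine ⟨h3.1.le, ?_⟩
          by_contra! hc
          have : |u - ‖h‖| < l := abs_lt.2 ⟨by linarith, by linarith [h3.2, norm_nonneg h]⟩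
          have := sq_lt_sq' (abs_lt.1 this).1 (abs_lt.1 this).2
          linarith
      _ = _ := by rw [Real.volume_Icc]; congr 1; ring
  · have : {u : ℝ | u ^ 2 + ‖y‖ ^ 2 < r ^ 2 ∧ r ^ 2 ≤ (u - ‖h‖) ^ 2 + ‖y‖ ^ 2} = ∅ := by
      ext u
      simp only [mem_ball_zero_iff, not_lt] at hy
      simp only [Set.mem_ofPred_eq, Set.mem_empty_iff_false, iff_false, not_and]
      intro h1
      nlinarith [sq_nonneg u, pow_le_pow_left₀ hr hy 2]
    rw [this, measure_empty]; exact zero_le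

lemma le_volume_ball_inter_shift_compl_of_le (n : ℕ) (hn : 1 ≤ n) {r : ℝ}
    (z h : EuclideanSpace ℝ (Fin (n + 1))) (hh : ‖h‖ / 2 ≤ r) :
    ENNReal.ofReal (volume.real (ball (0 : EuclideanSpace ℝ (Fin n)) 1) *
      (r - ‖h‖ / 2) ^ n * ‖h‖) ≤ volume {x | x ∈ ball z r ∧ x - h ∉ ball z r} := by
  have hh0 := norm_nonneg h
  have hr : 0 ≤ r := by linarith
  have hd : 0 ≤ r - ‖h‖ / 2 := by linarith
  rw [volume_ball_inter_shift_compl n hr, ENNReal.ofReal_mul (by positivity),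
    ← volume_ball_eq_ofReal_pow n hn hd 0, mul_comm, ← lintegral_indicator_const measurableSet_ball]
  refine lintegral_mono fun y ↦ ?_
  by_cases hy : y ∈ ball 0 (r - ‖h‖ / 2)
  · rw [Set.indicator_of_mem hy]
    rw [mem_ball_zero_iff] at hy
    have hy2 : ‖y‖ ^ 2 ≤ (r - ‖h‖ / 2) ^ 2 := pow_le_pow_left₀ (norm_nonneg y) hy.le 2
    have hpos : (‖h‖ / 2) ^ 2 ≤ r ^ 2 - ‖y‖ ^ 2 := by nlinarith
    set l := √(r ^ 2 - ‖y‖ ^ 2)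
    have hl2 : l ^ 2 = r ^ 2 - ‖y‖ ^ 2 := Real.sq_sqrt ((sq_nonneg _).trans hpos)
    have hl : ‖h‖ / 2 ≤ l := Real.le_sqrt_of_sq_le hpos
    calc ENNReal.ofReal ‖h‖ = volume (Set.Ioo (-l) (-l + ‖h‖)) := by
          rw [Real.volume_Ioo]; congr 1; ring
      _ ≤ _ := by
          refine measure_mono fun u ⟨h1, h2⟩ ↦ ⟨?_, ?_⟩
          · nlinarith
          · nlinarith
  · rw [Set.indicator_of_notMem hy]; exact zero_le

/-- First-order expansion, with quadratic error, of the volume of the part of a ball not covered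
by its translate by `h`. -/
lemma le_volume_ball_inter_shift_compl (n : ℕ) (hn : 1 ≤ n) {r : ℝ} (hr : 0 < r)
    (z h : EuclideanSpace ℝ (Fin (n + 1))) :
    ENNReal.ofReal (volume.real (ball (0 : EuclideanSpace ℝ (Fin n)) 1) * r ^ n * ‖h‖) ≤
      volume {x | x ∈ ball z r ∧ x - h ∉ ball z r} +
      ENNReal.ofReal (n * volume.real (ball (0 : EuclideanSpace ℝ (Fin n)) 1) *
        min (r ^ (n - 1) * ‖h‖ ^ 2) (r ^ n * ‖h‖)) := by
  set w := volume.real (ball (0 : EuclideanSpace ℝ (Fin n)) 1)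
  have hw : 0 ≤ w := measureReal_nonneg
  have hn' : (1 : ℝ) ≤ n := by exact_mod_cast hn
  have hh0 := norm_nonneg h
  have hrn : r ^ n = r * r ^ (n - 1) := by rw [← pow_succ', Nat.sub_add_cancel hn]
  have hr1 : 0 < r ^ (n - 1) := by positivity
  rcases le_total (r ^ (n - 1) * ‖h‖ ^ 2) (r ^ n * ‖h‖) with hle | hle
  · rw [min_eq_left hle]
    rcases le_total (‖h‖ / 2) r with hh | hh
    · refine le_trans ?_ (add_le_add_left (le_volume_ball_inter_shift_compl_of_le n hn z h hh) _)
      have hd : 0 ≤ r - ‖h‖ / 2 := by linarith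
      rw [← ENNReal.ofReal_add (by positivity) (by positivity)]
      apply ENNReal.ofReal_le_ofReal
      have hb := one_add_mul_le_pow (a := -(‖h‖ / 2 / r))
        (by have : ‖h‖ / 2 / r ≤ 1 := (div_le_one hr).2 hh
            linarith) n
      have e1 : r ^ n * (1 + -(‖h‖ / 2 / r)) ^ n = (r - ‖h‖ / 2) ^ n := by
        rw [← mul_pow]; congr 1; field_simp; ring
      have e2 : r ^ n * (1 + n * -(‖h‖ / 2 / r)) = r ^ n - n * r ^ (n - 1) * (‖h‖ / 2) := by
        rw [hrn]; field_simp; ring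
      have hb2 := mul_le_mul_of_nonneg_left hb (pow_nonneg hr.le n)
      rw [e1, e2] at hb2
      have hb3 := mul_le_mul_of_nonneg_left hb2 (mul_nonneg hw hh0)
      have : 0 ≤ n * w * (r ^ (n - 1) * ‖h‖ ^ 2) := by positivity
      nlinarith
    · refine le_add_left (ENNReal.ofReal_le_ofReal ?_)
      have h1 : r * ‖h‖ ≤ n * ‖h‖ ^ 2 := by nlinarith
      have := mul_le_mul_of_nonneg_left h1 (mul_nonneg hw hr1.le)
      rw [hrn]
      linarith
  · rw [min_eq_right hle]
    refine le_add_left (ENNReal.ofReal_le_ofReal ?_)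
    have : 0 ≤ w * r ^ n * ‖h‖ := by positivity
    nlinarith

/-- Comparison of a Riemann sum on `(0, ∞)` with the integral of an antitone function. -/
lemma tsum_ofReal_le_lintegral_of_antitoneOn {ψ : ℝ → ℝ} (hψ : AntitoneOn ψ (Set.Ioi 0)) {δ : ℝ}
    (hδ : 0 < δ) :
    (∑' i : ℕ, ENNReal.ofReal (ψ ((i + 1) * δ))) * ENNReal.ofReal δ ≤
      ∫⁻ y in Set.Ioi 0, ENNReal.ofReal (ψ y) := by
  have hdisj : Pairwise (Function.onFun Disjoint
      fun i : ℕ ↦ Set.Ioc ((i : ℝ) * δ) ((i + 1) * δ)) := by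
    have hmono : Monotone fun i : ℕ ↦ (i : ℝ) * δ := fun i j hij ↦ by
      dsimp only
      gcongr
    simpa using hmono.pairwise_disjoint_on_Ioc_succ
  rw [← ENNReal.tsum_mul_right]
  calc _ ≤ ∑' i : ℕ, ∫⁻ y in Set.Ioc ((i : ℝ) * δ) ((i + 1) * δ), ENNReal.ofReal (ψ y) := by
        refine ENNReal.tsum_le_tsum fun i ↦ ?_
        have hvol : volume (Set.Ioc ((i : ℝ) * δ) ((i + 1) * δ)) = ENNReal.ofReal δ := by
          rw [Real.volume_Ioc]; congr 1; ring
        rw [← hvol, ← setLIntegral_const]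
        refine setLIntegral_mono' measurableSet_Ioc fun y hy ↦ ENNReal.ofReal_le_ofReal ?_
        have h0 : 0 ≤ (i : ℝ) * δ := by positivity
        exact hψ (h0.trans_lt hy.1) (by positivity : (0 : ℝ) < (i + 1) * δ) hy.2
    _ = ∫⁻ y in ⋃ i : ℕ, Set.Ioc ((i : ℝ) * δ) ((i + 1) * δ), ENNReal.ofReal (ψ y) :=
        (lintegral_iUnion (fun _ ↦ measurableSet_Ioc) hdisj _).symm
    _ ≤ _ := by
        refine lintegral_mono_set (Set.iUnion_subset fun i y hy ↦ ?_)
        have h0 : 0 ≤ (i : ℝ) * δ := by positivity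
        exact h0.trans_lt hy.1

lemma lintegral_min_rpow_lt_top {p q : ℝ} (hp : -1 < p) (hq : q < -1) :
    ∫⁻ y in Set.Ioi (0 : ℝ), ENNReal.ofReal (min (y ^ p) (y ^ q)) < ∞ := by
  rw [← Set.Ioc_union_Ioi_eq_Ioi zero_le_one]
  refine (lintegral_union_le _ _ _).trans_lt (ENNReal.add_lt_top.2 ⟨?_, ?_⟩)
  · refine (lintegral_mono fun y ↦ ENNReal.ofReal_le_ofReal (min_le_left _ _)).trans_lt ?_
    have : IntegrableOn (fun y : ℝ ↦ y ^ p) (Set.Ioc 0 1) :=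
      (integrableOn_Ioc_iff_integrableOn_Ioo).2
        ((intervalIntegral.integrableOn_Ioo_rpow_iff one_pos).2 hp)
    exact this.lintegral_lt_top
  · refine (lintegral_mono fun y ↦ ENNReal.ofReal_le_ofReal (min_le_right _ _)).trans_lt ?_
    exact (integrableOn_Ioi_rpow_of_lt hq one_pos).lintegral_lt_top

/-- Summing the second-order errors, truncated at first order, over radii decaying like
`i ^ (-α)`. -/
lemma exists_tsum_min_le (k : ℕ) {α : ℝ} (hα : 0 < α) (hk : α * k < 1) (hk' : 1 < α * (k + 1)) :
    ∃ C : ℝ, 0 ≤ C ∧ ∀ (r : ℕ → ℝ), (∀ i, 0 ≤ r i) → (∀ i, r i ≤ ((i : ℝ) + 1) ^ (-α)) →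
      ∀ d : ℝ, 0 < d →
      ∑' i, ENNReal.ofReal (min (r i ^ k * d ^ 2) (r i ^ (k + 1) * d)) ≤
        ENNReal.ofReal (C * d ^ ((k : ℝ) + 2 - 1 / α)) := by
  set ψ : ℝ → ℝ := fun y ↦ min (y ^ (-(α * k))) (y ^ (-(α * (k + 1)))) with hψ
  have hI : ∫⁻ y in Set.Ioi (0 : ℝ), ENNReal.ofReal (ψ y) < ∞ :=
    lintegral_min_rpow_lt_top (by linarith) (by linarith)
  have hanti : AntitoneOn ψ (Set.Ioi 0) := fun x hx y _ hxy ↦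
    min_le_min (Real.rpow_le_rpow_of_nonpos hx hxy (neg_nonpos.2 (by positivity)))
      (Real.rpow_le_rpow_of_nonpos hx hxy (neg_nonpos.2 (by positivity)))
  refine ⟨(∫⁻ y in Set.Ioi (0 : ℝ), ENNReal.ofReal (ψ y)).toReal, ENNReal.toReal_nonneg,
    fun r hr0 hr d hd ↦ ?_⟩
  have hδ : 0 < d ^ (1 / α) := Real.rpow_pos_of_pos hd _
  have hterm (i : ℕ) : min (r i ^ k * d ^ 2) (r i ^ (k + 1) * d) ≤
      d ^ (k + 2) * ψ ((i + 1) * d ^ (1 / α)) := by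
    have hi : (0 : ℝ) < (i : ℝ) + 1 := by positivity
    have hscale (l : ℕ) : ((i + 1 : ℝ) * d ^ (1 / α)) ^ (-(α * l)) =
        (((i : ℝ) + 1) ^ (-α)) ^ l * (d ^ l)⁻¹ := by
      rw [Real.mul_rpow hi.le hδ.le, ← Real.rpow_mul hd.le, ← Real.rpow_natCast (_ ^ (-α)),
        ← Real.rpow_mul hi.le, ← Real.rpow_natCast d, ← Real.rpow_neg hd.le]
      congr 2
      · ring
      · field_simp
    have h1 := hscale k
    have h2 := hscale (k + 1)
    push_cast at h2
    simp only [hψ]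
    rw [h1, h2, mul_min_of_nonneg _ _ (by positivity)]
    refine min_le_min ?_ ?_
    · calc r i ^ k * d ^ 2 ≤ (((i : ℝ) + 1) ^ (-α)) ^ k * d ^ 2 := by
            gcongr
            · exact hr0 i
            · exact hr i
        _ = _ := by field_simp; ring
    · calc r i ^ (k + 1) * d ≤ (((i : ℝ) + 1) ^ (-α)) ^ (k + 1) * d := by
            gcongr
            · exact hr0 i
            · exact hr i
        _ = _ := by field_simp; ring
  have hsum := tsum_ofReal_le_lintegral_of_antitoneOn hanti hδ
  have hexp : d ^ ((k : ℝ) + 2 - 1 / α) = d ^ (k + 2) * (d ^ (1 / α))⁻¹ := by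
    rw [Real.rpow_sub hd, ← Nat.cast_two, ← Nat.cast_add, Real.rpow_natCast, div_eq_mul_inv]
  calc _ ≤ ∑' i : ℕ, ENNReal.ofReal (d ^ (k + 2)) *
          ENNReal.ofReal (ψ ((i + 1) * d ^ (1 / α))) := by
        refine ENNReal.tsum_le_tsum fun i ↦ ?_
        rw [← ENNReal.ofReal_mul (by positivity)]
        exact ENNReal.ofReal_le_ofReal (hterm i)
    _ = ENNReal.ofReal (d ^ (k + 2)) * ∑' i : ℕ, ENNReal.ofReal (ψ ((i + 1) * d ^ (1 / α))) :=
        ENNReal.tsum_mul_left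
    _ ≤ ENNReal.ofReal (d ^ (k + 2)) * ((∫⁻ y in Set.Ioi (0 : ℝ), ENNReal.ofReal (ψ y)) /
          ENNReal.ofReal (d ^ (1 / α))) := by
        gcongr
        rwa [ENNReal.le_div_iff_mul_le (Or.inl (by simpa using hδ)) (Or.inl ENNReal.ofReal_ne_top)]
    _ = _ := by
        rw [hexp, ENNReal.ofReal_mul ENNReal.toReal_nonneg, ENNReal.ofReal_toReal hI.ne,
          ENNReal.ofReal_mul (by positivity), ENNReal.ofReal_inv_of_pos hδ, div_eq_mul_inv]
        ring

lemma IsLatticeEnum.one_le_dist {m : ℕ} {z : ℕ → EuclideanSpace ℝ (Fin m)}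
    (hz : IsLatticeEnum m z) {i j : ℕ} (hij : i ≠ j) : 1 ≤ dist (z i) (z j) := by
  have hint (i : ℕ) : ∀ l : Fin m, ∃ k : ℤ, z i l = (k : ℝ) := by
    have : z i ∈ Set.range z := ⟨i, rfl⟩
    rwa [hz.2] at this
  obtain ⟨l, hl⟩ : ∃ l, z i l ≠ z j l := by
    by_contra! h
    exact hij (hz.1 (by ext l; exact h l))
  obtain ⟨p, hp⟩ := hint i l
  obtain ⟨q, hq⟩ := hint j l
  have hpq : p - q ≠ 0 := fun h ↦ hl (by rw [hp, hq, sub_eq_zero.1 h])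
  calc (1 : ℝ) ≤ |((p - q : ℤ) : ℝ)| := by exact_mod_cast Int.one_le_abs hpq
    _ = ‖(z i - z j) l‖ := by simp [hp, hq]
    _ ≤ ‖z i - z j‖ := PiLp.norm_apply_le _ l
    _ = dist (z i) (z j) := (dist_eq_norm _ _).symm

/-- For a small displacement the deficit of a union of well-separated balls is at least the sum of
the deficits of the balls. -/
lemma tsum_volume_le_volume_iUnion_inter_shift_compl {m : ℕ} {z : ℕ → EuclideanSpace ℝ (Fin m)}
    {r : ℕ → ℝ} (hz : ∀ i j, i ≠ j → 1 ≤ dist (z i) (z j)) (hr : ∀ i, r i ≤ 1 / 4)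
    {h : EuclideanSpace ℝ (Fin m)} (hh : ‖h‖ ≤ 1 / 2) :
    ∑' i, volume {x | x ∈ ball (z i) (r i) ∧ x - h ∉ ball (z i) (r i)} ≤
      volume {x | x ∈ ⋃ i, ball (z i) (r i) ∧ x - h ∉ ⋃ i, ball (z i) (r i)} := by
  have hm (i : ℕ) : MeasurableSet {x | x ∈ ball (z i) (r i) ∧ x - h ∉ ball (z i) (r i)} :=
    measurableSet_ball.inter ((measurable_id.sub_const h) measurableSet_ball.compl)
  rw [← measure_iUnion _ hm]
  · refine measure_mono (Set.iUnion_subset fun i x ⟨hx, hxh⟩ ↦ ⟨Set.mem_iUnion_of_mem i hx, ?_⟩)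
    rw [Set.mem_iUnion]
    rintro ⟨j, hj⟩
    have hij : i ≠ j := by rintro rfl; exact hxh hj
    have h1 := hz i j hij
    have h2 : dist x (x - h) = ‖h‖ := by simp
    have h3 := dist_triangle4 (z i) x (x - h) (z j)
    rw [mem_ball] at hx hj
    rw [dist_comm] at hx
    linarith [hr i, hr j]
  · refine fun i j hij ↦ Set.disjoint_left.2 fun x hx hx' ↦ ?_
    have h1 := hz i j hij
    have h2 := dist_triangle_left (z i) (z j) x
    have h3 := mem_ball.1 hx.1
    have h4 := mem_ball.1 hx'.1
    linarith [hr i, hr j]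

lemma volume_iUnion_inter_shift_compl_le {m : ℕ} (z : ℕ → EuclideanSpace ℝ (Fin m)) (r : ℕ → ℝ)
    (h : EuclideanSpace ℝ (Fin m)) :
    volume {x | x ∈ ⋃ i, ball (z i) (r i) ∧ x - h ∉ ⋃ i, ball (z i) (r i)} ≤
      ∑' i, volume {x | x ∈ ball (z i) (r i) ∧ x - h ∉ ball (z i) (r i)} := by
  refine (measure_mono ?_).trans (measure_iUnion_le _)
  rintro x ⟨hx, hxh⟩
  obtain ⟨i, hi⟩ := Set.mem_iUnion.1 hx
  exact Set.mem_iUnion_of_mem i ⟨hi, fun hc ↦ hxh (Set.mem_iUnion_of_mem i hc)⟩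

lemma exists_lintegral_heatKernel_mul_rpow_le (n : ℕ) {C q : ℝ} (hC : 0 ≤ C) (hq : 0 ≤ q) :
    ∃ c : ℝ, 0 ≤ c ∧ ∀ t : ℝ, 0 < t →
      ∫⁻ x : EuclideanSpace ℝ (Fin (n + 1)),
        ENNReal.ofReal (heatKernel t x) * ENNReal.ofReal (C * ‖x‖ ^ q) ≤
          ENNReal.ofReal (c * t ^ (q / 2)) := by
  have hG : 0 ≤ Real.Gamma (((n : ℝ) + 1 + q) / 2) := Real.Gamma_nonneg_of_nonneg (by positivity)
  refine ⟨C * ((((n : ℝ) + 1) * volume.real (ball (0 : EuclideanSpace ℝ (Fin (n + 1))) 1) *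
    (Real.pi ^ (-((n : ℝ) + 1) / 2) / 2 * Real.Gamma ((n + 1 + q) / 2))) * 4 ^ (q / 2)),
    by positivity, fun t ht ↦ le_of_eq ?_⟩
  have hk : Measurable (heatKernel t : EuclideanSpace ℝ (Fin (n + 1)) → ℝ) :=
    (continuous_heatKernel t).measurable
  calc _ = ∫⁻ x : EuclideanSpace ℝ (Fin (n + 1)),
        ENNReal.ofReal C * ENNReal.ofReal (heatKernel t x * ‖x‖ ^ q) := by
        refine lintegral_congr fun x ↦ ?_
        rw [← ENNReal.ofReal_mul (heatKernel_nonneg ht x), ← ENNReal.ofReal_mul hC]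
        congr 1; ring
    _ = _ := by
        rw [lintegral_const_mul _ (by fun_prop), lintegral_heatKernel_mul_rpow n ht hq,
          ← ENNReal.ofReal_mul hC, Real.mul_rpow (by norm_num) ht.le]
        congr 1; ring

/-- The deficit of a lattice union of balls with radii at most `i ^ (-α)`, to first order in the
displacement. -/
lemma exists_volume_iUnion_inter_shift_compl_bounds (k : ℕ) {α : ℝ} (hα : 0 < α)
    (hk : α * k < 1) (hk' : 1 < α * (k + 1)) {z : ℕ → EuclideanSpace ℝ (Fin (k + 1 + 1))}
    (hz : ∀ i j, i ≠ j → 1 ≤ dist (z i) (z j)) {r : ℕ → ℝ} (hr0 : ∀ i, 0 < r i)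
    (hr4 : ∀ i, r i ≤ 1 / 4) (hr : ∀ i, r i ≤ ((i : ℝ) + 1) ^ (-α))
    (hsum : Summable fun i ↦ r i ^ (k + 1)) {A : ℝ}
    (hA : A = volume.real (ball (0 : EuclideanSpace ℝ (Fin (k + 1))) 1) * ∑' i, r i ^ (k + 1)) :
    ∃ C : ℝ, 0 ≤ C ∧ ∀ h : EuclideanSpace ℝ (Fin (k + 1 + 1)),
      volume {x | x ∈ ⋃ i, ball (z i) (r i) ∧ x - h ∉ ⋃ i, ball (z i) (r i)} ≤
        ENNReal.ofReal (A * ‖h‖) ∧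
      ENNReal.ofReal (A * ‖h‖) ≤
        volume {x | x ∈ ⋃ i, ball (z i) (r i) ∧ x - h ∉ ⋃ i, ball (z i) (r i)} +
        (ENNReal.ofReal (C * ‖h‖ ^ ((k : ℝ) + 2 - 1 / α)) +
          ENNReal.ofReal (C * ‖h‖ ^ (2 : ℝ))) := by
  obtain ⟨C, hC, hbound⟩ := exists_tsum_min_le k hα hk hk'
  have hbound := hbound r (fun i ↦ (hr0 i).le) hr
  set w := volume.real (ball (0 : EuclideanSpace ℝ (Fin (k + 1))) 1)
  have hw0 : 0 ≤ w := measureReal_nonneg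
  have hA0 : 0 ≤ A := by
    rw [hA]; exact mul_nonneg hw0 (tsum_nonneg fun i ↦ pow_nonneg (hr0 i).le _)
  have hAsum (h : EuclideanSpace ℝ (Fin (k + 1 + 1))) :
      ENNReal.ofReal (A * ‖h‖) = ∑' i, ENNReal.ofReal (w * r i ^ (k + 1) * ‖h‖) := by
    rw [hA, ← tsum_mul_left, ← tsum_mul_right, ENNReal.ofReal_tsum_of_nonneg]
    · intro i
      have := hr0 i
      positivity
    · exact (hsum.mul_left w).mul_right _
  refine ⟨((k + 1 : ℕ) : ℝ) * w * C + 2 * A, by positivity, fun h ↦ ⟨?_, ?_⟩⟩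
  · rw [hAsum]
    refine (volume_iUnion_inter_shift_compl_le z r h).trans (ENNReal.tsum_le_tsum fun i ↦ ?_)
    exact volume_ball_inter_shift_compl_le (k + 1) k.succ_pos (hr0 i).le (z i) h
  · rcases eq_or_ne h 0 with rfl | hne
    · simp
    have hpos : 0 < ‖h‖ := norm_pos_iff.2 hne
    rcases le_total ‖h‖ (1 / 2) with hh | hh
    · rw [hAsum]
      calc _ ≤ ∑' i, (volume {x | x ∈ ball (z i) (r i) ∧ x - h ∉ ball (z i) (r i)} +
              ENNReal.ofReal (((k + 1 : ℕ) : ℝ) * w) *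
                ENNReal.ofReal (min (r i ^ k * ‖h‖ ^ 2) (r i ^ (k + 1) * ‖h‖))) := by
            refine ENNReal.tsum_le_tsum fun i ↦ ?_
            rw [← ENNReal.ofReal_mul (by positivity)]
            exact le_volume_ball_inter_shift_compl (k + 1) k.succ_pos (hr0 i) (z i) h
        _ = ∑' i, volume {x | x ∈ ball (z i) (r i) ∧ x - h ∉ ball (z i) (r i)} +
              ENNReal.ofReal (((k + 1 : ℕ) : ℝ) * w) *
                ∑' i, ENNReal.ofReal (min (r i ^ k * ‖h‖ ^ 2) (r i ^ (k + 1) * ‖h‖)) := by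
            rw [ENNReal.tsum_add, ENNReal.tsum_mul_left]
        _ ≤ _ := by
            refine add_le_add (tsum_volume_le_volume_iUnion_inter_shift_compl hz hr4 hh)
              (le_add_right ?_)
            refine (mul_le_mul_right (hbound ‖h‖ hpos) _).trans ?_
            rw [← ENNReal.ofReal_mul (by positivity), ← mul_assoc]
            apply ENNReal.ofReal_le_ofReal
            gcongr
            linarith
    · refine le_add_left (le_add_left (ENNReal.ofReal_le_ofReal ?_))
      rw [Real.rpow_two]
      calc A * ‖h‖ ≤ 2 * A * ‖h‖ ^ 2 := by nlinarith [mul_nonneg hA0 hpos.le]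
        _ ≤ _ := by
          gcongr
          have : 0 ≤ ((k + 1 : ℕ) : ℝ) * w * C := by positivity
          linarith

/-- Theorem 4, third regime (`m > 2` and `1/(m-1) < α < 1/(m-2)`, or `m = 2` and
`α > 1/(m-1) = 1`): for `Ω` the union of the balls `B(z_i; a i^{-α})` centred at the points
of `ℤᵐ`, the heat loss satisfies `F_Ω(t) = π^{-1/2} Per(Ω) t^{1/2} + O(t^{(mα-1)/(2α)})`
as `t ↓ 0`, where `Per(Ω) = ∑_i m ω_m r_i^{m-1}`. -/
theorem heat_loss_asymptotics_finite_perimeter_regime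
    (m : ℕ) (hm : 2 ≤ m) (a α : ℝ) (ha : 0 < a) (ha' : a ≤ 1 / 4)
    (hα : (2 < m ∧ 1 / ((m : ℝ) - 1) < α ∧ α < 1 / ((m : ℝ) - 2)) ∨
      (m = 2 ∧ 1 < α))
    (z : ℕ → EuclideanSpace ℝ (Fin m)) (hz : IsLatticeEnum m z)
    (r : ℕ → ℝ) (hr : ∀ i : ℕ, r i = a * ((i : ℝ) + 1) ^ (-α))
    (Ω : Set (EuclideanSpace ℝ (Fin m))) (hΩ : Ω = ⋃ i : ℕ, ball (z i) (r i))
    (ω : ℝ) (hω : ω = (volume (ball (0 : EuclideanSpace ℝ (Fin m)) 1)).toReal)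
    (P : ℝ) (hP : P = ∑' i : ℕ, (m : ℝ) * ω * r i ^ (m - 1)) :
    volume Ω ≠ ⊤ ∧
    ∃ t₀ > (0 : ℝ), ∃ K > (0 : ℝ), ∀ t : ℝ, 0 < t → t < t₀ →
      heatContent Ω t ≠ ⊤ ∧
      |((volume Ω).toReal - (heatContent Ω t).toReal) -
          Real.pi ^ (-(1 : ℝ) / 2) * P * Real.sqrt t| ≤
        K * t ^ (((m : ℝ) * α - 1) / (2 * α)) := by
  obtain ⟨k, rfl⟩ : ∃ k, m = k + 1 + 1 := ⟨m - 2, by omega⟩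
  obtain ⟨hα0, hk, hk'⟩ : 0 < α ∧ α * k < 1 ∧ 1 < α * (k + 1) := by
    rcases hα with ⟨h2, h1, h3⟩ | ⟨h2, h1⟩
    · have hk0 : (0 : ℝ) < k := by exact_mod_cast (by omega : 0 < k)
      push_cast at h1 h3
      have e1 : (k : ℝ) + 1 + 1 - 1 = k + 1 := by ring
      have e2 : (k : ℝ) + 1 + 1 - 2 = k := by ring
      rw [e1, div_lt_iff₀ (by positivity)] at h1
      rw [e2, lt_div_iff₀ hk0] at h3
      exact ⟨pos_of_mul_pos_left (one_pos.trans h1) (by positivity), h3, h1⟩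
    · obtain rfl : k = 0 := by omega
      exact ⟨by linarith, by simp, by simpa using h1⟩
  have hpow_pos (i : ℕ) : 0 < ((i : ℝ) + 1) ^ (-α) := by positivity
  have hpow_le (i : ℕ) : ((i : ℝ) + 1) ^ (-α) ≤ 1 :=
    Real.rpow_le_one_of_one_le_of_nonpos (by simp) (by linarith)
  have hr0 (i : ℕ) : 0 < r i := by rw [hr]; exact mul_pos ha (hpow_pos i)
  have hr1 (i : ℕ) : r i ≤ ((i : ℝ) + 1) ^ (-α) := by
    rw [hr]; exact mul_le_of_le_one_left (hpow_pos i).le (by linarith)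
  have hr4 (i : ℕ) : r i ≤ 1 / 4 := by
    rw [hr]; exact (mul_le_of_le_one_right ha.le (hpow_le i)).trans ha'
  have hsum : Summable fun i ↦ r i ^ (k + 1) := by
    have h := (Real.summable_one_div_nat_add_rpow 1 (α * (k + 1))).2 hk'
    refine Summable.of_nonneg_of_le (fun i ↦ pow_nonneg (hr0 i).le _) (fun i ↦ ?_) h
    have hi : (0 : ℝ) < (i : ℝ) + 1 := by positivity
    refine (pow_le_pow_left₀ (hr0 i).le (hr1 i) _).trans_eq ?_
    rw [abs_of_pos hi, one_div, ← Real.rpow_neg hi.le, ← Real.rpow_natCast, ← Real.rpow_mul hi.le]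
    push_cast
    congr 1; ring
  have hω0 : 0 ≤ ω := hω ▸ ENNReal.toReal_nonneg
  set w := volume.real (ball (0 : EuclideanSpace ℝ (Fin (k + 1))) 1)
  have hw0 : 0 ≤ w := measureReal_nonneg
  set S := ∑' i, r i ^ (k + 1) with hS
  have hS0 : 0 ≤ S := tsum_nonneg fun i ↦ pow_nonneg (hr0 i).le _
  have hPS : P = (((k + 1 : ℕ) : ℝ) + 1) * ω * S := by
    rw [hP, hS, ← tsum_mul_left]
    push_cast
    rfl
  have hΩm : MeasurableSet Ω := hΩ ▸ MeasurableSet.iUnion fun i ↦ measurableSet_ball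
  have hV : volume Ω ≠ ⊤ := by
    have hs2 : Summable fun i ↦ ω * r i ^ (k + 1 + 1) :=
      (Summable.of_nonneg_of_le (fun i ↦ pow_nonneg (hr0 i).le _)
        (fun i ↦ pow_le_pow_of_le_one (hr0 i).le ((hr4 i).trans (by norm_num))
          (Nat.le_succ _)) hsum).mul_left _
    rw [hΩ]
    refine ((measure_iUnion_le _).trans_lt ?_).ne
    have : ∀ i, volume (ball (z i) (r i)) = ENNReal.ofReal (ω * r i ^ (k + 1 + 1)) := fun i ↦ by
      rw [volume_ball_eq_ofReal_pow _ (Nat.succ_pos _) (hr0 i).le, hω, measureReal_def]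
    simp_rw [this]
    exact hs2.tsum_ofReal_lt_top
  obtain ⟨C, hC, hbd⟩ := exists_volume_iUnion_inter_shift_compl_bounds k hα0 hk hk'
    (fun i j hij ↦ hz.one_le_dist hij) hr0 hr4 hr1 hsum rfl
  rw [← hΩ] at hbd
  have hinv : 1 / α < k + 1 := by rw [div_lt_iff₀ hα0]; linarith
  have hinv' : (k : ℝ) < 1 / α := by rw [lt_div_iff₀ hα0]; linarith
  obtain ⟨c₁, hc₁, hm₁⟩ := exists_lintegral_heatKernel_mul_rpow_le (k + 1) hC
    (by linarith : 0 ≤ (k : ℝ) + 2 - 1 / α)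
  obtain ⟨c₂, hc₂, hm₂⟩ := exists_lintegral_heatKernel_mul_rpow_le (k + 1) hC zero_le_two
  refine ⟨hV, 1, one_pos, c₁ + c₂ + 1, by positivity, fun t ht ht1 ↦ ?_⟩
  have hdecomp := heatContent_add_lintegral (k + 1) hΩm ht
  set L := ∫⁻ h, ENNReal.ofReal (heatKernel t h) * volume {x | x ∈ Ω ∧ x - h ∉ Ω}
  have hHtop : heatContent Ω t ≠ ⊤ := ne_top_of_le_ne_top hV (hdecomp ▸ le_self_add)
  have hLtop : L ≠ ⊤ := ne_top_of_le_ne_top hV (hdecomp ▸ le_add_self)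
  refine ⟨hHtop, ?_⟩
  have hk_meas : Measurable (heatKernel t : EuclideanSpace ℝ (Fin (k + 1 + 1)) → ℝ) :=
    (continuous_heatKernel t).measurable
  have hfirst : ∫⁻ h : EuclideanSpace ℝ (Fin (k + 1 + 1)),
      ENNReal.ofReal (heatKernel t h) * ENNReal.ofReal (w * S * ‖h‖) =
      ENNReal.ofReal (Real.pi ^ (-(1 : ℝ) / 2) * P * √t) := by
    calc _ = ∫⁻ h : EuclideanSpace ℝ (Fin (k + 1 + 1)),
          ENNReal.ofReal S * (ENNReal.ofReal w * ENNReal.ofReal (heatKernel t h * ‖h‖)) := by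
          refine lintegral_congr fun h ↦ ?_
          rw [← ENNReal.ofReal_mul (heatKernel_nonneg ht h), ← ENNReal.ofReal_mul hw0,
            ← ENNReal.ofReal_mul hS0]
          congr 1; ring
      _ = _ := by
          rw [lintegral_const_mul _ (by fun_prop), lintegral_const_mul _ (by fun_prop),
            lintegral_heatKernel_mul_norm (k + 1) ht, ← ENNReal.ofReal_mul hS0, hPS, hω,
            measureReal_def]
          congr 1; ring
  have hupper : L ≤ ENNReal.ofReal (Real.pi ^ (-(1 : ℝ) / 2) * P * √t) := by
    rw [← hfirst]
    exact lintegral_mono fun h ↦ mul_le_mul_right (hbd h).1 _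
  have hs : ((k : ℝ) + 2 - 1 / α) / 2 = (((k + 1 + 1 : ℕ) : ℝ) * α - 1) / (2 * α) := by
    push_cast; field_simp; ring
  have hlower : ENNReal.ofReal (Real.pi ^ (-(1 : ℝ) / 2) * P * √t) ≤
      L + ENNReal.ofReal ((c₁ + c₂) * t ^ ((((k + 1 + 1 : ℕ) : ℝ) * α - 1) / (2 * α))) := by
    rw [← hfirst, ← hs]
    calc _ ≤ ∫⁻ h : EuclideanSpace ℝ (Fin (k + 1 + 1)),
          (ENNReal.ofReal (heatKernel t h) * volume {x | x ∈ Ω ∧ x - h ∉ Ω} +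
          (ENNReal.ofReal (heatKernel t h) *
            ENNReal.ofReal (C * ‖h‖ ^ ((k : ℝ) + 2 - 1 / α)) +
          ENNReal.ofReal (heatKernel t h) * ENNReal.ofReal (C * ‖h‖ ^ (2 : ℝ)))) :=
          lintegral_mono fun h ↦ by
            dsimp only
            rw [← mul_add, ← mul_add]
            exact mul_le_mul_right (hbd h).2 _
      _ = L + ((∫⁻ h : EuclideanSpace ℝ (Fin (k + 1 + 1)), ENNReal.ofReal (heatKernel t h) *
            ENNReal.ofReal (C * ‖h‖ ^ ((k : ℝ) + 2 - 1 / α))) +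
          ∫⁻ h : EuclideanSpace ℝ (Fin (k + 1 + 1)), ENNReal.ofReal (heatKernel t h) *
            ENNReal.ofReal (C * ‖h‖ ^ (2 : ℝ))) := by
          rw [lintegral_add_right _ (by fun_prop), lintegral_add_right _ (by fun_prop)]
      _ ≤ L + (ENNReal.ofReal (c₁ * t ^ (((k : ℝ) + 2 - 1 / α) / 2)) +
          ENNReal.ofReal (c₂ * t ^ ((2 : ℝ) / 2))) :=
          add_le_add_right (add_le_add (hm₁ t ht) (hm₂ t ht)) _
      _ ≤ _ := by
          rw [← ENNReal.ofReal_add (by positivity) (by positivity), add_mul]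
          have : t ^ ((2 : ℝ) / 2) ≤ t ^ (((k : ℝ) + 2 - 1 / α) / 2) :=
            Real.rpow_le_rpow_of_exponent_ge ht ht1.le (by linarith)
          gcongr
  have hP0 : 0 ≤ P := by rw [hPS]; positivity
  have hX : 0 ≤ Real.pi ^ (-(1 : ℝ) / 2) * P * √t := by positivity
  have hloss : (volume Ω).toReal - (heatContent Ω t).toReal = L.toReal := by
    rw [← hdecomp, ENNReal.toReal_add hHtop hLtop]; ring
  have hupper' := ENNReal.toReal_le_of_le_ofReal hX hupper
  have hts : 0 < t ^ ((((k + 1 + 1 : ℕ) : ℝ) * α - 1) / (2 * α)) := by positivity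
  rw [← ENNReal.ofReal_toReal hLtop, ← ENNReal.ofReal_add ENNReal.toReal_nonneg (by positivity),
    ENNReal.ofReal_le_ofReal_iff (by positivity)] at hlower
  rw [hloss, abs_le]
  constructor
  · linarith
  · have : 0 ≤ (c₁ + c₂ + 1) * t ^ ((((k + 1 + 1 : ℕ) : ℝ) * α - 1) / (2 * α)) := by positivity
    linarith
end

section
/- Let m > 2, 0 < a ≤ 1/4, and α > 1/(m−2). Let (z_i)_{i∈ℕ} be an enumeration of ℤ^m in ℝ^m, set r_i = a i^{-α}, and let Ω = ⋃_{i∈ℕ} B(z_i; r_i). Let F_Ω(t) = |Ω| − H_Ω(t) denote the heat loss and let P = ∑_{i=1}^∞ m ω_m (a i^{-α})^{m−1} (the perimeter of Ω), where ω_m is the volume of the unit ball in ℝ^m. Then, as t ↓ 0, F_Ω(t) − π^{-1/2} P t^{1/2} = O(t). -/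
open MeasureTheory Metric ENNReal

lemma integral_id_sq_gaussianReal_zero (v : NNReal) :
    ∫ s, s ^ 2 ∂(ProbabilityTheory.gaussianReal 0 v) = v := by
  have h := ProbabilityTheory.variance_fun_id_gaussianReal (μ := 0) (v := v)
  rwa [ProbabilityTheory.variance_of_integral_eq_zero (by fun_prop)
    (by simp)] at h

lemma integral_posPart_gaussianReal {t : ℝ} (ht : 0 < t) :
    ∫ s, max s 0 ∂(ProbabilityTheory.gaussianReal 0 (2 * t).toNNReal) =
      Real.pi ^ (-(1 : ℝ) / 2) * Real.sqrt t := by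
  have hv : (2 * t).toNNReal ≠ 0 := by simpa using ht
  have h1 : ∫ s in Set.Ioi (0 : ℝ), s * Real.exp (-(1 / (4 * t)) * s ^ 2) = 2 * t := by
    have := integral_rpow_mul_exp_neg_mul_rpow (p := 2) (q := 1) (b := 1 / (4 * t))
      (by norm_num) (by norm_num) (by positivity)
    norm_num [Real.rpow_neg_one] at this
    calc _ = _ := by congr with s; ring_nf
      _ = _ := this
      _ = _ := by ring
  rw [ProbabilityTheory.integral_gaussianReal_eq_integral_smul hv]
  have h2 : (fun s : ℝ => ProbabilityTheory.gaussianPDFReal 0 (2 * t).toNNReal s • max s 0) =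
      Set.indicator (Set.Ioi 0) (fun s => (Real.sqrt (4 * Real.pi * t))⁻¹ *
        (s * Real.exp (-(1 / (4 * t)) * s ^ 2))) := by
    ext s
    by_cases hs : 0 < s
    · rw [Set.indicator_of_mem (by exact hs), max_eq_left hs.le]
      simp only [ProbabilityTheory.gaussianPDFReal, smul_eq_mul, sub_zero]
      rw [Real.coe_toNNReal _ (by positivity)]
      ring_nf
    · rw [Set.indicator_of_notMem (by exact hs), max_eq_right (not_lt.1 hs), smul_zero]
  rw [h2, integral_indicator measurableSet_Ioi, integral_const_mul, h1, neg_div,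
    Real.rpow_neg Real.pi_pos.le, ← Real.sqrt_eq_rpow,
    show 4 * Real.pi * t = 2 ^ 2 * (Real.pi * t) by ring,
    Real.sqrt_mul (by positivity), Real.sqrt_sq (by norm_num), Real.sqrt_mul Real.pi_pos.le]
  have := Real.sqrt_pos.2 ht
  have := Real.sqrt_pos.2 Real.pi_pos
  field_simp
  exact (Real.sq_sqrt ht.le).symm

lemma pi_withDensity_ofReal {ι : Type*} [Fintype ι] {X : ι → Type*}
    [∀ i, MeasurableSpace (X i)] (μ : ∀ i, Measure (X i)) [∀ i, SigmaFinite (μ i)]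
    (f : ∀ i, X i → ℝ) (hf : ∀ i, Integrable (f i) (μ i)) (hf0 : ∀ i x, 0 ≤ f i x)
    [∀ i, SigmaFinite ((μ i).withDensity fun x => ENNReal.ofReal (f i x))] :
    Measure.pi (fun i => (μ i).withDensity fun x => ENNReal.ofReal (f i x)) =
      (Measure.pi μ).withDensity fun x => ENNReal.ofReal (∏ i, f i (x i)) := by
  refine Measure.pi_eq fun s hs => ?_
  rw [withDensity_apply _ (MeasurableSet.univ_pi hs), Measure.restrict_pi_pi,
    ← ofReal_integral_eq_lintegral_ofReal
      (Integrable.fintype_prod_dep fun i => (hf i).restrict)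
      (.of_forall fun x => Finset.prod_nonneg fun i _ => hf0 i _),
    integral_fintype_prod_eq_prod,
    ENNReal.ofReal_prod_of_nonneg fun i _ => integral_nonneg (hf0 i)]
  refine Finset.prod_congr rfl fun i _ => ?_
  rw [withDensity_apply _ (hs i), ofReal_integral_eq_lintegral_ofReal (hf i).restrict
    (.of_forall (hf0 i))]

/-- The centred heat kernel on `ℝᵐ` at time `t`. -/
noncomputable def heatDensity {m : ℕ} (t : ℝ) (w : EuclideanSpace ℝ (Fin m)) : ℝ :=
  (4 * Real.pi * t) ^ (-(m : ℝ) / 2) * Real.exp (-‖w‖ ^ 2 / (4 * t))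

/-- The law at time `t` of a heat particle started at the origin of `ℝᵐ`. -/
noncomputable def heatMeasure (m : ℕ) (t : ℝ) : Measure (EuclideanSpace ℝ (Fin m)) :=
  volume.withDensity fun w => ENNReal.ofReal (heatDensity t w)

@[fun_prop]
lemma measurable_heatDensity {m : ℕ} (t : ℝ) :
    Measurable (heatDensity t : EuclideanSpace ℝ (Fin m) → ℝ) := by
  unfold heatDensity
  fun_prop

lemma heatDensity_eq_prod {m : ℕ} {t : ℝ} (ht : 0 < t) (w : EuclideanSpace ℝ (Fin m)) :
    heatDensity t w =
      ∏ i, ProbabilityTheory.gaussianPDFReal 0 (2 * t).toNNReal (w i) := by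
  simp only [heatDensity, ProbabilityTheory.gaussianPDFReal, Finset.prod_mul_distrib,
    sub_zero, Finset.prod_const, Finset.card_univ, Fintype.card_fin, ← Real.exp_sum]
  rw [Real.coe_toNNReal _ (by positivity), EuclideanSpace.norm_sq_eq, ← Finset.sum_div]
  simp only [Real.norm_eq_abs, sq_abs, Finset.sum_neg_distrib]
  congr 1
  · rw [show 2 * Real.pi * (2 * t) = 4 * Real.pi * t by ring, neg_div,
      Real.rpow_neg (by positivity), inv_pow, Real.sqrt_eq_rpow, ← Real.rpow_natCast,
      ← Real.rpow_mul (by positivity)]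
    ring_nf
  · ring_nf

lemma measurePreserving_ofLp_heatMeasure (m : ℕ) {t : ℝ} (ht : 0 < t) :
    MeasurePreserving (WithLp.ofLp : EuclideanSpace ℝ (Fin m) → Fin m → ℝ) (heatMeasure m t)
      (Measure.pi fun _ => ProbabilityTheory.gaussianReal 0 (2 * t).toNNReal) := by
  have hv : (2 * t).toNNReal ≠ 0 := by simpa using ht
  have h := pi_withDensity_ofReal (fun _ : Fin m => (volume : Measure ℝ))
    (fun _ => ProbabilityTheory.gaussianPDFReal 0 (2 * t).toNNReal)
    (fun _ => ProbabilityTheory.integrable_gaussianPDFReal _ _)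
    (fun _ => ProbabilityTheory.gaussianPDFReal_nonneg _ _)
  refine ⟨by fun_prop, ?_⟩
  rw [funext fun _ : Fin m => ProbabilityTheory.gaussianReal_of_var_ne_zero 0 hv]
  refine Eq.trans ?_ h.symm
  ext s hs
  rw [Measure.map_apply (by fun_prop) hs, heatMeasure,
    withDensity_apply _ (by measurability), withDensity_apply _ hs, ← volume_pi,
    ← (PiLp.volume_preserving_ofLp (Fin m)).setLIntegral_comp_preimage hs (by fun_prop)]
  simp only [heatDensity_eq_prod ht]

lemma isProbabilityMeasure_heatMeasure (m : ℕ) {t : ℝ} (ht : 0 < t) :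
    IsProbabilityMeasure (heatMeasure m t) :=
  ⟨by rw [← Set.preimage_univ, (measurePreserving_ofLp_heatMeasure m ht).measure_preimage
    nullMeasurableSet_univ,
    measure_univ]⟩

lemma measurePreserving_coord_heatMeasure {m : ℕ} {t : ℝ} (ht : 0 < t) (j : Fin m) :
    MeasurePreserving (fun w : EuclideanSpace ℝ (Fin m) => w j) (heatMeasure m t)
      (ProbabilityTheory.gaussianReal 0 (2 * t).toNNReal) :=
  (measurePreserving_eval _ j).comp (measurePreserving_ofLp_heatMeasure m ht)

lemma integrable_coord_sq_heatMeasure {m : ℕ} {t : ℝ} (ht : 0 < t) (j : Fin m) :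
    Integrable (fun w : EuclideanSpace ℝ (Fin m) => w j ^ 2) (heatMeasure m t) := by
  have h := (ProbabilityTheory.memLp_id_gaussianReal (μ := 0) (v := (2 * t).toNNReal)
    2).integrable_sq
  exact ((measurePreserving_coord_heatMeasure ht j).integrable_comp
    h.aestronglyMeasurable).2 h

lemma integrable_norm_sq_heatMeasure {m : ℕ} {t : ℝ} (ht : 0 < t) :
    Integrable (fun w : EuclideanSpace ℝ (Fin m) => ‖w‖ ^ 2) (heatMeasure m t) := by
  simp only [EuclideanSpace.norm_sq_eq, Real.norm_eq_abs, sq_abs]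
  exact integrable_finsetSum _ fun j _ => integrable_coord_sq_heatMeasure ht j

lemma integral_norm_sq_heatMeasure {m : ℕ} {t : ℝ} (ht : 0 < t) :
    ∫ w : EuclideanSpace ℝ (Fin m), ‖w‖ ^ 2 ∂(heatMeasure m t) = 2 * m * t := by
  simp only [EuclideanSpace.norm_sq_eq, Real.norm_eq_abs, sq_abs]
  rw [integral_finsetSum _ fun j _ => integrable_coord_sq_heatMeasure ht j]
  have h (j : Fin m) : ∫ w : EuclideanSpace ℝ (Fin m), w j ^ 2 ∂(heatMeasure m t) = 2 * t := by
    have hmp := measurePreserving_coord_heatMeasure ht j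
    rw [← Real.coe_toNNReal (2 * t) (by positivity), ← integral_id_sq_gaussianReal_zero,
      ← hmp.map_eq, integral_map hmp.aemeasurable (by fun_prop)]
  simp only [h, Finset.sum_const, Finset.card_univ, Fintype.card_fin, nsmul_eq_mul]
  ring

lemma integrable_posPart_coord_heatMeasure {m : ℕ} {t : ℝ} (ht : 0 < t) (j : Fin m) :
    Integrable (fun w : EuclideanSpace ℝ (Fin m) => max (w j) 0) (heatMeasure m t) := by
  have h := ((ProbabilityTheory.memLp_id_gaussianReal (μ := 0) (v := (2 * t).toNNReal)
    1).integrable le_rfl).pos_part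
  exact ((measurePreserving_coord_heatMeasure ht j).integrable_comp
    h.aestronglyMeasurable).2 h

lemma integral_posPart_coord_heatMeasure {m : ℕ} {t : ℝ} (ht : 0 < t) (j : Fin m) :
    ∫ w : EuclideanSpace ℝ (Fin m), max (w j) 0 ∂(heatMeasure m t) =
      Real.pi ^ (-(1 : ℝ) / 2) * Real.sqrt t := by
  have hmp := measurePreserving_coord_heatMeasure ht j
  rw [← integral_posPart_gaussianReal ht, ← hmp.map_eq,
    integral_map hmp.aemeasurable (by fun_prop)]

lemma heatMeasure_le_norm {m : ℕ} {t : ℝ} (ht : 0 < t) {δ : ℝ} (hδ : 0 < δ) :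
    (heatMeasure m t).real {w | δ ≤ ‖w‖} ≤ 2 * m * t / δ ^ 2 := by
  have h := mul_meas_ge_le_integral_of_nonneg (μ := heatMeasure m t)
    (.of_forall fun w => sq_nonneg ‖w‖) (integrable_norm_sq_heatMeasure ht) (δ ^ 2)
  rw [integral_norm_sq_heatMeasure ht] at h
  rw [le_div_iff₀ (by positivity), mul_comm]
  simpa only [pow_le_pow_iff_left₀ hδ.le (norm_nonneg _) two_ne_zero] using h

lemma heatMeasure_map_linearIsometryEquiv {m : ℕ} (t : ℝ)
    (e : EuclideanSpace ℝ (Fin m) ≃ₗᵢ[ℝ] EuclideanSpace ℝ (Fin m)) :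
    MeasurePreserving e (heatMeasure m t) (heatMeasure m t) := by
  refine ⟨by fun_prop, ?_⟩
  ext s hs
  rw [Measure.map_apply (by fun_prop) hs, heatMeasure,
    withDensity_apply _ (hs.preimage (by fun_prop)), withDensity_apply _ hs,
    ← e.measurePreserving.setLIntegral_comp_preimage hs (by fun_prop)]
  simp only [heatDensity, e.norm_map]

lemma heatMeasure_exit_eq_of_norm_eq {m : ℕ} (t r : ℝ) {x y : EuclideanSpace ℝ (Fin m)}
    (hxy : ‖x‖ = ‖y‖) :
    (heatMeasure m t).real {w | r ≤ ‖x + w‖} = (heatMeasure m t).real {w | r ≤ ‖y + w‖} := by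
  let e := Submodule.reflection (ℝ ∙ (x - y))ᗮ
  have hxe : e x = y := Submodule.reflection_sub hxy
  have h := (heatMeasure_map_linearIsometryEquiv t e).measureReal_preimage
    (s := {w | r ≤ ‖y + w‖}) (measurableSet_le (by fun_prop) (by fun_prop)).nullMeasurableSet
  rw [← h, ← hxe]
  simp only [Set.preimage_ofPred_eq, ← map_add, e.norm_map]

/-- The part of the segment `(0, r)` along a unit vector that a translation by a vector `w`
moves out of the ball of radius `r`; here `s` is the component of `w` along the segment and
`Q` is its squared length. -/
def exitSegment (r s Q : ℝ) : Set ℝ := {y ∈ Set.Ioo 0 r | r ^ 2 ≤ y ^ 2 + 2 * y * s + Q}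

lemma measurableSet_exitSegment (r s Q : ℝ) : MeasurableSet (exitSegment r s Q) := by
  have h : MeasurableSet {y : ℝ | r ^ 2 ≤ y ^ 2 + 2 * y * s + Q} :=
    measurableSet_le (by fun_prop) (by fun_prop)
  exact measurableSet_Ioo.inter h

lemma exitSegment_subset_Ico {r s Q : ℝ} (hr : 0 < r) (hsQ : s ^ 2 ≤ Q) (hQ : Q < r ^ 2) :
    exitSegment r s Q ⊆ Set.Ico (r - (max s 0 + Q / r)) r := by
  rintro y ⟨⟨hy0, hyr⟩, hy⟩
  refine ⟨?_, hyr⟩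
  have hQ0 : 0 ≤ Q := (sq_nonneg s).trans hsQ
  have hpos : 0 < y + s := by
    by_contra! h
    nlinarith [mul_nonneg hy0.le (neg_nonneg.2 h)]
  have hmax := le_max_left s 0
  rcases le_or_gt r (y + s) with h | h
  · have : 0 ≤ Q / r := by positivity
    linarith
  · have : r - (y + s) ≤ Q / r := by
      rw [le_div_iff₀ hr]
      nlinarith [mul_nonneg (sub_nonneg.2 h.le) hpos.le, sq_nonneg s]
    linarith

lemma abs_integral_exitSegment_sub_le {r s Q : ℝ} (hr : 0 < r) (hsQ : s ^ 2 ≤ Q) (n : ℕ) :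
    |(∫ y in exitSegment r s Q, y ^ (n + 1)) - r ^ (n + 1) * max s 0| ≤
      (n + 2) * r ^ n * Q := by
  have hQ0 : 0 ≤ Q := (sq_nonneg s).trans hsQ
  have hS : exitSegment r s Q ⊆ Set.Ioo 0 r := fun y hy => hy.1
  have hint : IntegrableOn (fun y : ℝ => y ^ (n + 1)) (Set.Ioo 0 r) :=
    ((continuous_pow (n + 1)).integrableOn_Icc (a := 0) (b := r)).mono_set Set.Ioo_subset_Icc_self
  have hL0 : 0 ≤ ∫ y in exitSegment r s Q, y ^ (n + 1) :=
    setIntegral_nonneg (measurableSet_exitSegment r s Q) fun y hy => pow_nonneg (hS hy).1.le _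
  have hrn : 0 < r ^ n := by positivity
  have hrnQ : 0 ≤ r ^ n * Q := by positivity
  have hup (l : ℝ) (hl : 0 ≤ l) (h : exitSegment r s Q ⊆ Set.Ico (r - l) r) :
      ∫ y in exitSegment r s Q, y ^ (n + 1) ≤ r ^ (n + 1) * l := by
    have hfin : volume (exitSegment r s Q) ≠ ⊤ :=
      ne_top_of_le_ne_top (by simp) (measure_mono hS)
    calc ∫ y in exitSegment r s Q, y ^ (n + 1)
        ≤ ∫ y in exitSegment r s Q, r ^ (n + 1) := by
          refine setIntegral_mono_on (hint.mono_set hS) (integrableOn_const hfin)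
            (measurableSet_exitSegment r s Q) fun y hy => ?_
          exact pow_le_pow_left₀ (hS hy).1.le (hS hy).2.le _
      _ = volume.real (exitSegment r s Q) * r ^ (n + 1) := by simp
      _ ≤ l * r ^ (n + 1) := by
          gcongr
          refine (measureReal_mono h (by simp)).trans ?_
          rw [Real.volume_real_Ico_of_le (by linarith)]
          linarith
      _ = _ := mul_comm _ _
  rw [abs_le]
  constructor
  · rcases le_or_gt s 0 with hs | hs
    · rw [max_eq_right hs]
      nlinarith
    rw [max_eq_left hs.le]
    rcases le_or_gt r s with hrs | hrs
    · have : r ^ (n + 1) * s ≤ r ^ n * Q := by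
        rw [pow_succ, mul_assoc]
        gcongr
        nlinarith
      nlinarith
    have hsub : Set.Ioo (r - s) r ⊆ exitSegment r s Q := fun y hy =>
      ⟨⟨by linarith [hy.1], hy.2⟩, by nlinarith [hy.1]⟩
    have hlow : s * (r - s) ^ (n + 1) ≤ ∫ y in exitSegment r s Q, y ^ (n + 1) := by
      calc s * (r - s) ^ (n + 1) = ∫ y in Set.Ioo (r - s) r, (r - s) ^ (n + 1) := by
            simp [hs.le]
        _ ≤ ∫ y in Set.Ioo (r - s) r, y ^ (n + 1) := by
            refine setIntegral_mono_on (integrableOn_const (by simp))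
              (hint.mono_set (hsub.trans hS)) measurableSet_Ioo fun y hy => ?_
            exact pow_le_pow_left₀ (by linarith) hy.1.le _
        _ ≤ _ := by
            refine setIntegral_mono_set (hint.mono_set hS) ?_ (.of_forall hsub)
            filter_upwards [ae_restrict_mem (measurableSet_exitSegment r s Q)] with y hy
            exact pow_nonneg (hS hy).1.le _
    have hbern : r ^ (n + 1) - (n + 1) * r ^ n * s ≤ (r - s) ^ (n + 1) := by
      have h := one_add_mul_le_pow (a := -(s / r)) (by
        have : s / r ≤ 1 := (div_le_one hr).2 hrs.le
        linarith) (n + 1)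
      calc r ^ (n + 1) - (n + 1) * r ^ n * s
          = r ^ (n + 1) * (1 + ((n + 1 : ℕ) : ℝ) * -(s / r)) := by
            push_cast
            field_simp
            ring
        _ ≤ r ^ (n + 1) * (1 + -(s / r)) ^ (n + 1) := by gcongr
        _ = (r - s) ^ (n + 1) := by
            rw [← mul_pow]
            congr 1
            field_simp
            ring
    have h1 := mul_le_mul_of_nonneg_left hbern hs.le
    have h2 : (n + 1) * r ^ n * s ^ 2 ≤ (n + 1) * r ^ n * Q := by gcongr
    nlinarith
  · rcases le_or_gt (r ^ 2) Q with h | h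
    · have h1 := hup r hr.le fun y hy => ⟨by simpa using (hS hy).1.le, (hS hy).2⟩
      have h2 : r ^ (n + 1) * r ≤ r ^ n * Q := by
        rw [pow_succ, mul_assoc, ← sq]
        gcongr
      have h3 : 0 ≤ r ^ (n + 1) * max s 0 := by positivity
      nlinarith
    · have h1 := hup _ (by positivity) (exitSegment_subset_Ico hr hsQ h)
      have h2 : r ^ (n + 1) * (max s 0 + Q / r) = r ^ (n + 1) * max s 0 + r ^ n * Q := by
        field_simp
        ring
      nlinarith

lemma norm_smul_single_add_sq {m : ℕ} (j : Fin m) (y : ℝ) (w : EuclideanSpace ℝ (Fin m)) :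
    ‖y • EuclideanSpace.single j (1 : ℝ) + w‖ ^ 2 = y ^ 2 + 2 * y * w j + ‖w‖ ^ 2 := by
  rw [norm_add_sq_real, norm_smul, PiLp.norm_single, real_inner_smul_left,
    EuclideanSpace.inner_single_left]
  simp
  ring

/-- Polar coordinates: the heat lost by a ball is a Gaussian average over exit segments. -/
lemma integral_ball_heatMeasure_exit {m : ℕ} (j : Fin m) {t : ℝ} (ht : 0 < t) {r : ℝ}
    (hr : 0 < r) :
    Integrable (fun w : EuclideanSpace ℝ (Fin m) =>
      ∫ y in exitSegment r (w j) (‖w‖ ^ 2), y ^ (m - 1)) (heatMeasure m t) ∧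
    ∫ x in ball (0 : EuclideanSpace ℝ (Fin m)) r, (heatMeasure m t).real {w | r ≤ ‖x + w‖} =
      m * volume.real (ball (0 : EuclideanSpace ℝ (Fin m)) 1) *
        ∫ w, (∫ y in exitSegment r (w j) (‖w‖ ^ 2), y ^ (m - 1)) ∂(heatMeasure m t) := by
  have := isProbabilityMeasure_heatMeasure m ht
  have : Nonempty (Fin m) := ⟨j⟩
  set e : EuclideanSpace ℝ (Fin m) := EuclideanSpace.single j 1
  have he : ‖e‖ = 1 := by simp [e]
  let Φ : ℝ → ℝ := fun y => (heatMeasure m t).real {w | r ≤ ‖y • e + w‖}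
  let S : Set (ℝ × EuclideanSpace ℝ (Fin m)) := {p | r ≤ ‖p.1 • e + p.2‖}
  have hS : MeasurableSet S := measurableSet_le (by fun_prop) (by fun_prop)
  have hmem (y : ℝ) (w : EuclideanSpace ℝ (Fin m)) (hy : y ∈ Set.Ioo 0 r) :
      y ∈ exitSegment r (w j) (‖w‖ ^ 2) ↔ (y, w) ∈ S := by
    simp only [exitSegment, Set.mem_ofPred_eq, hy, true_and, S, e,
      ← norm_smul_single_add_sq]
    exact pow_le_pow_iff_left₀ hr.le (norm_nonneg _) two_ne_zero
  have hint : Integrable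
      (Function.uncurry fun (y : ℝ) (w : EuclideanSpace ℝ (Fin m)) =>
        S.indicator (fun p => p.1 ^ (m - 1)) (y, w))
      ((volume.restrict (Set.Ioo 0 r)).prod (heatMeasure m t)) := by
    have hpow : IntegrableOn (fun y : ℝ => y ^ (m - 1)) (Set.Ioo 0 r) :=
      ((continuous_pow _).integrableOn_Icc (a := 0) (b := r)).mono_set Set.Ioo_subset_Icc_self
    exact (hpow.integrable.comp_fst (heatMeasure m t)).indicator hS
  have hL (w : EuclideanSpace ℝ (Fin m)) :
      ∫ y in Set.Ioo 0 r, S.indicator (fun p => p.1 ^ (m - 1)) (y, w) =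
        ∫ y in exitSegment r (w j) (‖w‖ ^ 2), y ^ (m - 1) := by
    rw [← Set.inter_eq_right.2 (show exitSegment r (w j) (‖w‖ ^ 2) ⊆ Set.Ioo 0 r from
      fun y hy => hy.1), ← setIntegral_indicator (measurableSet_exitSegment _ _ _)]
    refine setIntegral_congr_fun measurableSet_Ioo fun y hy => ?_
    simp [Set.indicator, hmem y w hy]
  refine ⟨by simpa only [Function.uncurry_apply_pair, hL] using hint.integral_prod_right, ?_⟩
  calc _ = ∫ x, (Set.Iio r).indicator Φ ‖x‖ := by
        rw [← integral_indicator measurableSet_ball]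
        congr with x
        by_cases hx : ‖x‖ < r
        · rw [Set.indicator_of_mem (by simpa using hx), Set.indicator_of_mem (by exact hx)]
          exact heatMeasure_exit_eq_of_norm_eq t r (by simp [norm_smul, he])
        · rw [Set.indicator_of_notMem (by simpa using hx), Set.indicator_of_notMem (by exact hx)]
    _ = m * volume.real (ball (0 : EuclideanSpace ℝ (Fin m)) 1) *
          ∫ y in Set.Ioo 0 r, y ^ (m - 1) * Φ y := by
        rw [integral_fun_norm_addHaar]
        simp only [finrank_euclideanSpace, Fintype.card_fin, nsmul_eq_mul, smul_eq_mul, mul_assoc]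
        rw [← Set.Ioi_inter_Iio, ← setIntegral_indicator measurableSet_Iio]
        simp only [Set.indicator_mul_right]
    _ = _ := by
        congr 1
        calc _ = ∫ y in Set.Ioo 0 r, ∫ w, S.indicator (fun p => p.1 ^ (m - 1)) (y, w)
                  ∂(heatMeasure m t) := by
              refine setIntegral_congr_fun measurableSet_Ioo fun y hy => ?_
              have h : (fun w => S.indicator (fun p : ℝ × EuclideanSpace ℝ (Fin m) =>
                  p.1 ^ (m - 1)) (y, w)) = {w | r ≤ ‖y • e + w‖}.indicator
                    fun _ => y ^ (m - 1) := by
                ext w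
                simp [Set.indicator, S]
              simp only [h]
              rw [integral_indicator (measurableSet_le (by fun_prop) (by fun_prop))]
              simp [Φ, mul_comm]
          _ = ∫ w, (∫ y in Set.Ioo 0 r, S.indicator (fun p => p.1 ^ (m - 1)) (y, w))
                  ∂(heatMeasure m t) := integral_integral_swap hint
          _ = _ := by simp only [hL]

lemma abs_integral_ball_heatMeasure_exit_sub_le {m : ℕ} (hm : 2 ≤ m) {t : ℝ} (ht : 0 < t)
    {r : ℝ} (hr : 0 < r) :
    |(∫ x in ball (0 : EuclideanSpace ℝ (Fin m)) r, (heatMeasure m t).real {w | r ≤ ‖x + w‖}) -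
        Real.pi ^ (-(1 : ℝ) / 2) *
          (m * volume.real (ball (0 : EuclideanSpace ℝ (Fin m)) 1) * r ^ (m - 1)) * Real.sqrt t| ≤
      2 * m ^ 3 * volume.real (ball (0 : EuclideanSpace ℝ (Fin m)) 1) * r ^ (m - 2) * t := by
  obtain ⟨n, rfl⟩ := Nat.exists_eq_add_of_le' hm
  let j : Fin (n + 2) := 0
  obtain ⟨hint, heq⟩ := integral_ball_heatMeasure_exit j ht hr
  rw [heq]
  simp only [Nat.add_sub_cancel, show n + 2 - 1 = n + 1 from rfl] at hint ⊢
  set ω := volume.real (ball (0 : EuclideanSpace ℝ (Fin (n + 2))) 1)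
  set L : EuclideanSpace ℝ (Fin (n + 2)) → ℝ := fun w =>
    ∫ y in exitSegment r (w j) (‖w‖ ^ 2), y ^ (n + 1)
  have hω : 0 ≤ ω := measureReal_nonneg
  have hbound (w : EuclideanSpace ℝ (Fin (n + 2))) :
      ‖L w - r ^ (n + 1) * max (w j) 0‖ ≤ (n + 2) * r ^ n * ‖w‖ ^ 2 := by
    refine abs_integral_exitSegment_sub_le hr ?_ n
    exact sq_le_sq' (neg_le_of_abs_le (PiLp.norm_apply_le w j))
      (le_of_abs_le (PiLp.norm_apply_le w j))
  have hmain : |(∫ w, L w ∂(heatMeasure (n + 2) t)) -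
      r ^ (n + 1) * (Real.pi ^ (-(1 : ℝ) / 2) * Real.sqrt t)| ≤
        (n + 2) * r ^ n * (2 * (n + 2 : ℕ) * t) := by
    rw [← integral_posPart_coord_heatMeasure ht j, ← integral_const_mul,
      ← integral_sub hint ((integrable_posPart_coord_heatMeasure ht j).const_mul _),
      ← integral_norm_sq_heatMeasure ht, ← integral_const_mul]
    exact norm_integral_le_of_norm_le ((integrable_norm_sq_heatMeasure ht).const_mul _)
      (.of_forall hbound)
  push_cast at hmain ⊢
  calc _ = (n + 2) * ω * |(∫ w, L w ∂(heatMeasure (n + 2) t)) -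
      r ^ (n + 1) * (Real.pi ^ (-(1 : ℝ) / 2) * Real.sqrt t)| := by
        rw [← abs_of_nonneg (show 0 ≤ (n + 2) * ω by positivity), ← abs_mul,
          abs_of_nonneg (show 0 ≤ (n + 2) * ω by positivity)]
        congr 1
        ring
    _ ≤ (n + 2) * ω * ((n + 2) * r ^ n * (2 * (n + 2) * t)) := by gcongr
    _ = _ := by ring

lemma heatContent_eq_lintegral_heatMeasure {m : ℕ} {Ω : Set (EuclideanSpace ℝ (Fin m))}
    (hΩ : MeasurableSet Ω) (t : ℝ) :
    heatContent Ω t = ∫⁻ x in Ω, heatMeasure m t {w | x + w ∈ Ω} := by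
  refine lintegral_congr fun x => ?_
  change _ = heatMeasure m t ((x + ·) ⁻¹' Ω)
  rw [heatMeasure, withDensity_apply _ (hΩ.preimage (measurable_const_add x)),
    ← (measurePreserving_add_left volume x).setLIntegral_comp_preimage hΩ (by fun_prop)]
  simp [heatDensity]

lemma measurable_heatMeasure_exit {m : ℕ} {t : ℝ} (ht : 0 < t)
    {Ω : Set (EuclideanSpace ℝ (Fin m))} (hΩ : MeasurableSet Ω) :
    Measurable fun x => heatMeasure m t {w | x + w ∉ Ω} := by
  have := isProbabilityMeasure_heatMeasure m ht
  exact measurable_measure_prodMk_left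
    (s := {p : EuclideanSpace ℝ (Fin m) × EuclideanSpace ℝ (Fin m) | p.1 + p.2 ∉ Ω})
    (hΩ.compl.preimage (by fun_prop))

lemma integrable_heatMeasure_exit {m : ℕ} {t : ℝ} (ht : 0 < t)
    {Ω A : Set (EuclideanSpace ℝ (Fin m))} (hΩ : MeasurableSet Ω) (hA : volume A ≠ ⊤) :
    IntegrableOn (fun x => (heatMeasure m t).real {w | x + w ∉ Ω}) A := by
  have := isProbabilityMeasure_heatMeasure m ht
  have hmeas := measurable_heatMeasure_exit ht hΩ
  refine Integrable.mono' (g := fun _ => 1) (integrableOn_const hA)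
    hmeas.ennreal_toReal.aestronglyMeasurable (.of_forall fun x => ?_)
  rw [Real.norm_of_nonneg measureReal_nonneg]
  exact measureReal_le_one

lemma heatLoss_eq_integral_heatMeasure {m : ℕ} {t : ℝ} (ht : 0 < t)
    {Ω : Set (EuclideanSpace ℝ (Fin m))} (hΩ : MeasurableSet Ω) (hfin : volume Ω ≠ ⊤) :
    heatContent Ω t ≠ ⊤ ∧ (volume Ω).toReal - (heatContent Ω t).toReal =
      ∫ x in Ω, (heatMeasure m t).real {w | x + w ∉ Ω} := by
  have := isProbabilityMeasure_heatMeasure m ht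
  have hmeas := measurable_heatMeasure_exit ht hΩ
  have hsum : heatContent Ω t + ∫⁻ x in Ω, heatMeasure m t {w | x + w ∉ Ω} = volume Ω := by
    rw [heatContent_eq_lintegral_heatMeasure hΩ, ← lintegral_add_right _ hmeas]
    have h (x : EuclideanSpace ℝ (Fin m)) :
        heatMeasure m t {w | x + w ∈ Ω} + heatMeasure m t {w | x + w ∉ Ω} = 1 :=
      prob_add_prob_compl (hΩ.preimage (measurable_const_add x))
    simp [h]
  have hH : heatContent Ω t ≠ ⊤ := ne_top_of_le_ne_top hfin (hsum ▸ le_self_add)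
  have hF : ∫⁻ x in Ω, heatMeasure m t {w | x + w ∉ Ω} ≠ ⊤ :=
    ne_top_of_le_ne_top hfin (hsum ▸ le_add_self)
  refine ⟨hH, ?_⟩
  rw [← hsum, ENNReal.toReal_add hH hF, add_sub_cancel_left]
  exact (integral_toReal hmeas.aemeasurable (.of_forall fun x => measure_lt_top _ _)).symm

lemma integral_ball_heatMeasure_exit_translate {m : ℕ} (t : ℝ) (c : EuclideanSpace ℝ (Fin m))
    (r : ℝ) :
    ∫ x in ball c r, (heatMeasure m t).real {w | x + w ∉ ball c r} =
      ∫ x in ball (0 : EuclideanSpace ℝ (Fin m)) r,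
        (heatMeasure m t).real {w | r ≤ ‖x + w‖} := by
  have h := (measurePreserving_add_left (volume : Measure (EuclideanSpace ℝ (Fin m)))
    c).setIntegral_preimage_emb (measurableEmbedding_addLeft c)
      (fun x => (heatMeasure m t).real {w | x + w ∉ ball c r}) (ball c r)
  rw [← h]
  simp [mem_ball, dist_eq_norm, add_assoc]

/-- Replacing a ball by a larger set all of whose other points are at distance at least `δ`
changes the heat lost by the ball by `O(t)`. -/
lemma abs_integral_heatMeasure_exit_sub_le {m : ℕ} {t δ : ℝ} (ht : 0 < t) (hδ : 0 < δ)
    {A Ω : Set (EuclideanSpace ℝ (Fin m))} (hA : MeasurableSet A) (hΩ : MeasurableSet Ω)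
    (hAfin : volume A ≠ ⊤) (hAΩ : A ⊆ Ω) (hsep : ∀ x ∈ A, ∀ y ∈ Ω \ A, δ ≤ dist x y) :
    |(∫ x in A, (heatMeasure m t).real {w | x + w ∉ Ω}) -
        ∫ x in A, (heatMeasure m t).real {w | x + w ∉ A}| ≤
      2 * m * t / δ ^ 2 * volume.real A := by
  have := isProbabilityMeasure_heatMeasure m ht
  rw [← integral_sub (integrable_heatMeasure_exit ht hΩ hAfin)
    (integrable_heatMeasure_exit ht hA hAfin)]
  rw [← Real.norm_eq_abs]
  refine norm_setIntegral_le_of_norm_le_const hAfin.lt_top fun x hx => ?_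
  have h1 : (heatMeasure m t).real {w | x + w ∉ Ω} ≤ (heatMeasure m t).real {w | x + w ∉ A} :=
    measureReal_mono fun w hw h => hw (hAΩ h)
  have h2 : (heatMeasure m t).real {w | x + w ∉ A} ≤
      (heatMeasure m t).real {w | x + w ∉ Ω} + (heatMeasure m t).real {w | δ ≤ ‖w‖} := by
    refine (measureReal_mono fun w hw => ?_).trans (measureReal_union_le _ _)
    by_cases h : x + w ∈ Ω
    · exact .inr (by simpa [dist_eq_norm] using hsep x hx (x + w) ⟨h, hw⟩)
    · exact .inl h
  rw [Real.norm_eq_abs, abs_sub_comm, abs_of_nonneg (sub_nonneg.2 h1)]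
  linarith [heatMeasure_le_norm (m := m) ht hδ]

lemma volume_real_ball_eq {m : ℕ} (c : EuclideanSpace ℝ (Fin m)) {r : ℝ} (hr : 0 < r) :
    volume.real (ball c r) =
      r ^ m * volume.real (ball (0 : EuclideanSpace ℝ (Fin m)) 1) := by
  rw [measureReal_def, Measure.addHaar_ball_of_pos _ _ hr]
  simp [measureReal_def, hr.le]

/-- Theorem 4, fourth regime `m > 2`, `α > 1/(m-2)`: for `Ω` the union of the balls
`B(z_i; a i^{-α})` centred at the points of `ℤᵐ`, the heat loss satisfies
`F_Ω(t) = π^{-1/2} Per(Ω) t^{1/2} + O(t)` as `t ↓ 0`, where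
`Per(Ω) = ∑_i m ω_m r_i^{m-1}`. -/
theorem heat_loss_asymptotics_fourth_regime
    (m : ℕ) (hm : 2 < m) (a α : ℝ) (ha : 0 < a) (ha' : a ≤ 1 / 4)
    (hα : 1 / ((m : ℝ) - 2) < α)
    (z : ℕ → EuclideanSpace ℝ (Fin m)) (hz : IsLatticeEnum m z)
    (r : ℕ → ℝ) (hr : ∀ i : ℕ, r i = a * ((i : ℝ) + 1) ^ (-α))
    (Ω : Set (EuclideanSpace ℝ (Fin m))) (hΩ : Ω = ⋃ i : ℕ, ball (z i) (r i))
    (ω : ℝ) (hω : ω = (volume (ball (0 : EuclideanSpace ℝ (Fin m)) 1)).toReal)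
    (P : ℝ) (hP : P = ∑' i : ℕ, (m : ℝ) * ω * r i ^ (m - 1)) :
    volume Ω ≠ ⊤ ∧
    ∃ t₀ > (0 : ℝ), ∃ K > (0 : ℝ), ∀ t : ℝ, 0 < t → t < t₀ →
      heatContent Ω t ≠ ⊤ ∧
      |((volume Ω).toReal - (heatContent Ω t).toReal) -
          Real.pi ^ (-(1 : ℝ) / 2) * P * Real.sqrt t| ≤
        K * t := by

  have hi1 (i : ℕ) : (1 : ℝ) ≤ (i : ℝ) + 1 := by simp
  have hm2 : (0 : ℝ) < (m : ℝ) - 2 := by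
    rw [sub_pos]
    exact_mod_cast hm
  have hα0 : 0 < α := (by positivity : 0 < 1 / ((m : ℝ) - 2)).trans hα
  have hr0 (i : ℕ) : 0 < r i := by
    rw [hr]
    positivity
  have hr4 (i : ℕ) : r i ≤ 1 / 4 := by
    rw [hr]
    have := Real.rpow_le_one_of_one_le_of_nonpos (hi1 i) (neg_nonpos.2 hα0.le)
    nlinarith
  have hr1 (i : ℕ) : r i ≤ 1 := (hr4 i).trans (by norm_num)
  have hω0 : 0 ≤ ω := hω ▸ ENNReal.toReal_nonneg
  have hsum2 : Summable fun i => r i ^ (m - 2) := by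
    have h : Summable fun i : ℕ => 1 / |(i : ℝ) + 1| ^ (α * ((m : ℝ) - 2)) := by
      rw [Real.summable_one_div_nat_add_rpow]
      rwa [div_lt_iff₀ hm2] at hα
    refine (h.mul_left (a ^ (m - 2))).congr fun i => ?_
    rw [hr, mul_pow, abs_of_pos (by positivity), ← Real.rpow_natCast (_ ^ (-α)),
      ← Real.rpow_mul (by positivity), Nat.cast_sub hm.le, neg_mul, Real.rpow_neg (by positivity),
      one_div, Nat.cast_ofNat]
  have hle (k : ℕ) (hk : m - 2 ≤ k) (i : ℕ) : r i ^ k ≤ r i ^ (m - 2) :=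
    pow_le_pow_of_le_one (hr0 i).le (hr1 i) hk
  have hsum (k : ℕ) (hk : m - 2 ≤ k) : Summable fun i => r i ^ k :=
    hsum2.of_nonneg_of_le (fun i => (pow_pos (hr0 i) k).le) (hle k hk)
  have htsum : 0 ≤ ∑' i, r i ^ (m - 2) := tsum_nonneg fun i => (pow_pos (hr0 i) _).le
  have hsep (i j : ℕ) (hij : i ≠ j) (x : EuclideanSpace ℝ (Fin m)) (hx : x ∈ ball (z i) (r i))
      (y : EuclideanSpace ℝ (Fin m)) (hy : y ∈ ball (z j) (r j)) : 1 / 2 ≤ dist x y := by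
    have h1 := hz.one_le_dist hij
    have h2 := dist_triangle4 (z i) x y (z j)
    rw [mem_ball] at hx hy
    rw [dist_comm (z i) x] at h2
    linarith [hr4 i, hr4 j]
  have hdisj : Pairwise (Function.onFun Disjoint fun i => ball (z i) (r i)) := fun i j hij =>
    Set.disjoint_left.2 fun x hxi hxj => by
      have := hsep i j hij x hxi x hxj
      norm_num at this
  have hΩm : MeasurableSet Ω := hΩ ▸ .iUnion fun i => measurableSet_ball
  have hvol (i : ℕ) : volume.real (ball (z i) (r i)) = r i ^ m * ω := by
    rw [volume_real_ball_eq _ (hr0 i), hω, measureReal_def]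
  have hfin : volume Ω ≠ ⊤ := by
    rw [hΩ, measure_iUnion hdisj fun i => measurableSet_ball]
    have h (i : ℕ) : volume (ball (z i) (r i)) = ENNReal.ofReal (r i ^ m * ω) := by
      rw [← hvol, ofReal_measureReal]
    simp only [h]
    exact ((hsum m (by omega)).mul_right ω).tsum_ofReal_ne_top
  refine ⟨hfin, 1, one_pos, (2 * m ^ 3 + 8 * m) * ω * (∑' i, r i ^ (m - 2)) + 1, by positivity,
    fun t ht _ => ?_⟩
  obtain ⟨hH, hF⟩ := heatLoss_eq_integral_heatMeasure ht hΩm hfin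
  refine ⟨hH, ?_⟩
  rw [hF]
  have hFsum : HasSum (fun i => ∫ x in ball (z i) (r i), (heatMeasure m t).real {w | x + w ∉ Ω})
      (∫ x in Ω, (heatMeasure m t).real {w | x + w ∉ Ω}) := by
    have h := hasSum_integral_iUnion (fun i => measurableSet_ball) hdisj
      (hΩ ▸ integrable_heatMeasure_exit ht hΩm hfin)
    rwa [← hΩ] at h
  have hPsum : HasSum (fun i => Real.pi ^ (-(1 : ℝ) / 2) * (m * ω * r i ^ (m - 1)) * Real.sqrt t)
      (Real.pi ^ (-(1 : ℝ) / 2) * P * Real.sqrt t) := by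
    rw [hP]
    exact ((((hsum (m - 1) (by omega)).mul_left (m * ω)).hasSum).mul_left _).mul_right _
  have hterm (i : ℕ) :
      ‖(∫ x in ball (z i) (r i), (heatMeasure m t).real {w | x + w ∉ Ω}) -
        Real.pi ^ (-(1 : ℝ) / 2) * (m * ω * r i ^ (m - 1)) * Real.sqrt t‖ ≤
      (2 * m ^ 3 + 8 * m) * ω * t * r i ^ (m - 2) := by
    have h1 := abs_integral_heatMeasure_exit_sub_le ht (δ := 1 / 2) (by norm_num)
      (measurableSet_ball (x := z i) (ε := r i)) hΩm measure_ball_lt_top.ne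
      (hΩ ▸ Set.subset_iUnion (fun i => ball (z i) (r i)) i) (fun x hx y hy => by
        rw [hΩ] at hy
        obtain ⟨j, hj⟩ := Set.mem_iUnion.1 hy.1
        exact hsep i j (fun h => hy.2 (h ▸ hj)) x hx y hj)
    have h2 := abs_integral_ball_heatMeasure_exit_sub_le hm.le ht (hr0 i)
    rw [← integral_ball_heatMeasure_exit_translate t (z i), measureReal_def, ← hω] at h2
    rw [hvol] at h1
    have h3 : 8 * m * t * ω * r i ^ m ≤ 8 * m * t * ω * r i ^ (m - 2) := by
      gcongr ?_ * ?_
      exact hle m (by omega) i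
    rw [Real.norm_eq_abs]
    refine (abs_sub_le _ _ _).trans ((add_le_add h1 h2).trans ?_)
    linear_combination h3
  rw [← (hFsum.sub hPsum).tsum_eq]
  calc _ ≤ ∑' i, (2 * m ^ 3 + 8 * m) * ω * t * r i ^ (m - 2) :=
        tsum_of_norm_bounded (hsum2.mul_left _).hasSum hterm
    _ = (2 * m ^ 3 + 8 * m) * ω * (∑' i, r i ^ (m - 2)) * t := by
        rw [tsum_mul_left]
        ring
    _ ≤ _ := by gcongr; simp
end
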